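/- Let G ∈ 𝒢 with host tree T, and let X ⊆ D_T′ ∪ {u ∈ V(G) : deg_G(u) = 2}. If |X| ≤ 2, then ν_ur(G − X) = ν_ur(G), where G − X is the subgraph of G induced on V(G) \ X. -/

import Mathlib

open SimpleGraph

namespace URPaper

/-- `M` is a matching in the simple graph `G`: a finite set of edges of `G`
that are pairwise vertex-disjoint. -/
def IsMatchingSet {V : Type*} (G : SimpleGraph V) (M : Finset (Sym2 V)) : Prop :=
  (∀ e ∈ M, e ∈ G.edgeSet) ∧
    ∀ e ∈ M, ∀ f ∈ M, e ≠ f → ∀ v : V, v ∈ e → v ∉ f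

/-- The set of vertices covered by a set of edges. -/
def covered {V : Type*} (M : Finset (Sym2 V)) : Set V := {v | ∃ e ∈ M, v ∈ e}

/-- A matching `M` in `G` is uniquely restricted if no other matching of `G`
covers exactly the same set of vertices. -/
def IsURMatching {V : Type*} (G : SimpleGraph V) (M : Finset (Sym2 V)) : Prop :=
  IsMatchingSet G M ∧
    ∀ M' : Finset (Sym2 V), IsMatchingSet G M' → covered M' = covered M → M' = M

/-- The matching number `ν(G)`: the maximum size of a matching in `G`. -/
noncomputable def nu {V : Type*} (G : SimpleGraph V) : ℕ :=
  sSup {k | ∃ M : Finset (Sym2 V), IsMatchingSet G M ∧ M.card = k}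

/-- The uniquely restricted matching number `ν_ur(G)`: the maximum size of a
uniquely restricted matching in `G`. -/
noncomputable def nuUR {V : Type*} (G : SimpleGraph V) : ℕ :=
  sSup {k | ∃ M : Finset (Sym2 V), IsURMatching G M ∧ M.card = k}

/-- `D_G`: the set of vertices missed by at least one maximum matching of `G`. -/
def gallaiD {V : Type*} (G : SimpleGraph V) : Set V :=
  {v | ∃ M : Finset (Sym2 V), IsMatchingSet G M ∧ M.card = nu G ∧ v ∉ covered M}

/-- `A_G`: the set of vertices outside `D_G` having a neighbor in `D_G`. -/
def gallaiA {V : Type*} (G : SimpleGraph V) : Set V :=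
  {v | v ∉ gallaiD G ∧ ∃ u ∈ gallaiD G, G.Adj v u}

/-- `C_G = V(G) \ (A_G ∪ D_G)`. -/
def gallaiC {V : Type*} (G : SimpleGraph V) : Set V :=
  {v | v ∉ gallaiD G ∧ v ∉ gallaiA G}

/-- Membership in the family `𝒯`: trees `T` with `ν(T) = (n(T) - 1)/3`
(equivalently `3 ν(T) + 1 = n(T)`) such that every vertex of `A_T` has degree
at most `3` in `T`. -/
def MemT {V : Type*} (T : SimpleGraph V) : Prop :=
  T.IsTree ∧ (∀ v ∈ gallaiA T, (T.neighborSet v).ncard ≤ 3) ∧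
    3 * nu T + 1 = Nat.card V

/-- The graph obtained from `T` by contracting the set `S` to a single new
vertex (the vertex `none`), all other vertices being kept. -/
def contractSet {V : Type*} (T : SimpleGraph V) (S : Set V) :
    SimpleGraph (Option {x : V // x ∉ S}) where
  Adj a b :=
    match a, b with
    | some x, some y => T.Adj x y
    | some x, none => ∃ u ∈ S, T.Adj (x : V) u
    | none, some y => ∃ u ∈ S, T.Adj (y : V) u
    | none, none => False
  symm := by
    refine ⟨?_⟩
    rintro (_ | x) (_ | y) h
    · exact h
    · exact h
    · exact h
    · exact T.adj_symm h
  loopless := by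
    refine ⟨?_⟩
    rintro (_ | x) h
    · exact h
    · exact T.loopless.irrefl _ h

/-- The graph `BG1` from the paper, given by an explicit edge list. -/
def BG1 : SimpleGraph (Fin 10) :=
  SimpleGraph.fromEdgeSet {s(0,4), s(1,4), s(0,5), s(2,5), s(0,6), s(3,6), s(1,7), s(2,7), s(1,8), s(3,8), s(2,9), s(3,9)}

/-- The graph `BG2` from the paper, given by an explicit edge list. -/
def BG2 : SimpleGraph (Fin 13) :=
  SimpleGraph.fromEdgeSet {s(0,4), s(1,4), s(0,5), s(2,5), s(0,6), s(3,6), s(1,7), s(2,7), s(1,8), s(3,8), s(2,9), s(3,9), s(10,6), s(10,7), s(11,8), s(11,5), s(12,4), s(12,9)}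

/-- The graph `BG3` from the paper, given by an explicit edge list. -/
def BG3 : SimpleGraph (Fin 16) :=
  SimpleGraph.fromEdgeSet {s(0,1), s(1,2), s(2,3), s(3,4), s(4,5), s(5,0), s(6,7), s(7,8), s(8,9), s(9,10), s(10,11), s(11,6), s(12,0), s(12,6), s(13,2), s(13,8), s(14,4), s(14,10), s(15,12), s(15,13), s(15,14)}

/-- The graph `BG4` from the paper, given by an explicit edge list. -/
def BG4 : SimpleGraph (Fin 19) :=
  SimpleGraph.fromEdgeSet {s(0,1), s(1,2), s(2,3), s(3,4), s(4,5), s(5,0), s(6,7), s(7,8), s(8,9), s(9,10), s(10,11), s(11,6), s(12,0), s(13,1), s(14,2), s(15,3), s(16,4), s(17,5), s(12,6), s(13,7), s(14,8), s(15,9), s(16,10), s(17,11), s(18,12), s(18,14), s(18,16)}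

/-- The graph `BG5` from the paper, given by an explicit edge list. -/
def BG5 : SimpleGraph (Fin 16) :=
  SimpleGraph.fromEdgeSet {s(0,4), s(1,4), s(0,5), s(2,5), s(0,6), s(3,6), s(1,7), s(2,7), s(1,8), s(3,8), s(2,9), s(3,9), s(10,6), s(10,7), s(11,8), s(11,5), s(12,4), s(12,9), s(13,14), s(14,15), s(13,10), s(13,11), s(15,12)}

/-- The graph `BG6` from the paper, given by an explicit edge list. -/
def BG6 : SimpleGraph (Fin 19) :=
  SimpleGraph.fromEdgeSet {s(0,4), s(1,4), s(0,5), s(2,5), s(0,6), s(3,6), s(1,7), s(2,7), s(1,8), s(3,8), s(2,9), s(3,9), s(10,6), s(10,7), s(11,8), s(11,5), s(12,4), s(12,9), s(13,14), s(14,15), s(15,16), s(16,17), s(17,18), s(18,13), s(13,10), s(15,11), s(17,12)}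

/-- The graph `BG7` from the paper, given by an explicit edge list. -/
def BG7 : SimpleGraph (Fin 19) :=
  SimpleGraph.fromEdgeSet {s(0,1), s(1,2), s(2,3), s(3,4), s(4,5), s(5,0), s(6,7), s(7,8), s(8,9), s(9,10), s(10,11), s(11,6), s(12,0), s(12,6), s(13,2), s(13,8), s(14,4), s(14,10), s(15,12), s(15,13), s(15,14), s(17,16), s(16,18), s(17,9), s(17,5), s(18,3), s(18,11)}

/-- The graph `BG8` from the paper, given by an explicit edge list. -/
def BG8 : SimpleGraph (Fin 22) :=
  SimpleGraph.fromEdgeSet {s(0,1), s(1,2), s(2,3), s(3,4), s(4,5), s(5,0), s(6,7), s(7,8), s(8,9), s(9,10), s(10,11), s(11,6), s(12,0), s(13,1), s(14,2), s(15,3), s(16,4), s(17,5), s(12,6), s(13,7), s(14,8), s(15,9), s(16,10), s(17,11), s(18,12), s(18,14), s(18,16), s(19,20), s(20,21), s(19,13), s(19,15), s(21,17)}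

/-- The graph `BG9` from the paper, given by an explicit edge list. -/
def BG9 : SimpleGraph (Fin 25) :=
  SimpleGraph.fromEdgeSet {s(0,1), s(1,2), s(2,3), s(3,4), s(4,5), s(5,0), s(6,7), s(7,8), s(8,9), s(9,10), s(10,11), s(11,6), s(12,0), s(13,1), s(14,2), s(15,3), s(16,4), s(17,5), s(12,6), s(13,7), s(14,8), s(15,9), s(16,10), s(17,11), s(18,12), s(18,14), s(18,16), s(19,20), s(20,21), s(21,22), s(22,23), s(23,24), s(24,19), s(19,13), s(21,15), s(23,17)}

/-- The graph `GraphH1` from the paper, given by an explicit edge list. -/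
def GraphH1 : SimpleGraph (Fin 14) :=
  SimpleGraph.fromEdgeSet {s(0,4), s(1,4), s(0,5), s(2,5), s(0,6), s(3,6), s(1,7), s(2,7), s(1,8), s(3,8), s(2,9), s(3,9), s(10,6), s(10,7), s(11,8), s(11,5), s(12,4), s(12,9), s(13,10), s(13,11), s(13,12)}

/-- The graph `GraphH2` from the paper, given by an explicit edge list. -/
def GraphH2 : SimpleGraph (Fin 20) :=
  SimpleGraph.fromEdgeSet {s(0,1), s(1,2), s(2,3), s(3,4), s(4,5), s(5,0), s(6,7), s(7,8), s(8,9), s(9,10), s(10,11), s(11,6), s(12,0), s(13,1), s(14,2), s(15,3), s(16,4), s(17,5), s(12,6), s(13,7), s(14,8), s(15,9), s(16,10), s(17,11), s(18,12), s(18,14), s(18,16), s(19,13), s(19,15), s(19,17)}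

/-- Membership in the family `ℬ = {G₁, …, G₉}`, up to isomorphism. -/
def IsBlockB : ∀ (X : Type), SimpleGraph X → Prop := fun _ H =>
  Nonempty (H ≃g BG1) ∨ Nonempty (H ≃g BG2) ∨ Nonempty (H ≃g BG3) ∨
  Nonempty (H ≃g BG4) ∨ Nonempty (H ≃g BG5) ∨ Nonempty (H ≃g BG6) ∨
  Nonempty (H ≃g BG7) ∨ Nonempty (H ≃g BG8) ∨ Nonempty (H ≃g BG9)

/-- Membership in the family `ℬ_c = {G₁, G₂, G₃, G₄}`, up to isomorphism. -/
def IsBlockBc : ∀ (X : Type), SimpleGraph X → Prop := fun _ H =>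
  Nonempty (H ≃g BG1) ∨ Nonempty (H ≃g BG2) ∨ Nonempty (H ≃g BG3) ∨ Nonempty (H ≃g BG4)

/-- `G` (on vertex set `W`) arises from the tree `T` (on vertex set `V`) by
replacing every vertex of `S` by a graph from the family `𝓑`.  The map `π`
sends every vertex of `G` to the vertex of `T` it corresponds to:
* every fiber over a vertex outside `S` is a single vertex, and on these
  vertices `π` is an isomorphism with the corresponding induced subgraph of `T`;
* the fiber over a vertex `s ∈ S` induces a graph of the family `𝓑`;
* there are no edges between the fibers of two distinct vertices of `S`;
* for `s ∈ S` and `v ∉ S`, there is exactly one edge of `G` between the two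
  fibers if `sv ∈ E(T)` and none otherwise;
* each vertex of a fiber over `s ∈ S` has at most one neighbor outside this
  fiber (distinct attachment vertices), and a vertex of such a fiber having a
  neighbor outside the fiber has exactly two neighbors inside it
  (attachment only at vertices of degree `2` of the replacing graph). -/
def ArisesFrom (𝓑 : ∀ (X : Type), SimpleGraph X → Prop) {W V : Type}
    (G : SimpleGraph W) (T : SimpleGraph V) (S : Set V) (π : W → V) : Prop :=
  Function.Surjective π ∧
  (∀ v ∉ S, ∀ w w' : W, π w = v → π w' = v → w = w') ∧
  (∀ w w' : W, π w ∉ S → π w' ∉ S → (G.Adj w w' ↔ T.Adj (π w) (π w'))) ∧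
  (∀ s ∈ S, 𝓑 _ (G.induce (π ⁻¹' {s}))) ∧
  (∀ s ∈ S, ∀ s' ∈ S, s ≠ s' → ∀ w w' : W, π w = s → π w' = s' → ¬ G.Adj w w') ∧
  (∀ s ∈ S, ∀ v ∉ S, T.Adj s v →
    ∃! p : W × W, π p.1 = s ∧ π p.2 = v ∧ G.Adj p.1 p.2) ∧
  (∀ s ∈ S, ∀ v ∉ S, ¬ T.Adj s v →
    ∀ w w' : W, π w = s → π w' = v → ¬ G.Adj w w') ∧
  (∀ s ∈ S, ∀ w : W, π w = s → ∀ w₁ w₂ : W, π w₁ ≠ s → π w₂ ≠ s →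
    G.Adj w w₁ → G.Adj w w₂ → w₁ = w₂) ∧
  (∀ s ∈ S, ∀ w : W, π w = s → ∀ w' : W, π w' ≠ s → G.Adj w w' →
    (G.neighborSet w ∩ π ⁻¹' {s}).ncard = 2)

/-- Membership in the family `𝒢`: graphs arising from a tree `T ∈ 𝒯` by
replacing each vertex of a subset `S ⊆ D_T` by a graph of the family `ℬ`. -/
def InCalG {W : Type} (G : SimpleGraph W) : Prop :=
  ∃ (V : Type) (T : SimpleGraph V) (S : Set V) (π : W → V),
    Finite V ∧ MemT T ∧ S ⊆ gallaiD T ∧ ArisesFrom IsBlockB G T S π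

/-- `κ_G(P)`: the number of connected components of `G` whose induced graph
satisfies the (isomorphism invariant) predicate `P`. -/
noncomputable def kappa {W : Type} (G : SimpleGraph W)
    (P : ∀ (X : Type), SimpleGraph X → Prop) : ℕ :=
  Nat.card {c : G.ConnectedComponent // P _ (G.induce c.supp)}

/-- Membership in `𝒢₃`: cubic graphs of girth at least `5`. -/
def IsCubicGirth5 : ∀ (X : Type), SimpleGraph X → Prop := fun _ H =>
  (∀ v, (H.neighborSet v).ncard = 3) ∧ 5 ≤ H.egirth

/-- Being isomorphic to `H₁` or `H₂`. -/
def IsH1orH2 : ∀ (X : Type), SimpleGraph X → Prop := fun _ H =>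
  Nonempty (H ≃g GraphH1) ∨ Nonempty (H ≃g GraphH2)


theorem ur_subset {V : Type*} {G : SimpleGraph V} {M M0 : Finset (Sym2 V)}
    (h : IsURMatching G M) (hs : M0 ⊆ M) : IsURMatching G M0 := by
  classical
  refine ⟨⟨fun e he => h.1.1 e (hs he), fun e he f hf => h.1.2 e (hs he) f (hs hf)⟩, ?_⟩
  intro M1 h1 hc
  have hdis : ∀ e ∈ M1, ∀ f ∈ M \ M0, ∀ v : V, v ∈ e → v ∉ f := by
    intro e he f hf v hv hvf
    have : v ∈ covered M1 := ⟨e, he, hv⟩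
    rw [hc] at this
    obtain ⟨g, hg, hvg⟩ := this
    rw [Finset.mem_sdiff] at hf
    have hne : g ≠ f := fun hh => hf.2 (hh ▸ hg)
    exact h.1.2 g (hs hg) f hf.1 hne v hvg hvf
  have key := h.2 (M1 ∪ (M \ M0)) ?_ ?_
  · ext e
    constructor
    · intro he
      have heM : e ∈ M := by rw [← key]; exact Finset.mem_union_left _ he
      by_contra hne
      induction e using Sym2.ind with
      | _ x y => exact hdis _ he _ (Finset.mem_sdiff.2 ⟨heM, hne⟩) x (Sym2.mem_mk_left _ _) (Sym2.mem_mk_left _ _)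
    · intro he
      have heM : e ∈ M1 ∪ (M \ M0) := by rw [key]; exact hs he
      rcases Finset.mem_union.1 heM with h2 | h2
      · exact h2
      · exact absurd he (Finset.mem_sdiff.1 h2).2
  · refine ⟨?_, ?_⟩
    · intro e he
      rcases Finset.mem_union.1 he with h2 | h2
      · exact h1.1 e h2
      · exact h.1.1 e (Finset.mem_sdiff.1 h2).1
    · intro e he f hf hne v hv hvf
      rcases Finset.mem_union.1 he with h2 | h2 <;> rcases Finset.mem_union.1 hf with h3 | h3
      · exact h1.2 e h2 f h3 hne v hv hvf
      · exact hdis e h2 f h3 v hv hvf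
      · exact hdis f h3 e h2 v hvf hv
      · exact h.1.2 e (Finset.mem_sdiff.1 h2).1 f (Finset.mem_sdiff.1 h3).1 hne v hv hvf
  · ext v
    have hv : v ∈ covered M1 ↔ v ∈ covered M0 := by rw [hc]
    simp only [covered, Set.mem_ofPred_eq, Finset.mem_union, Finset.mem_sdiff] at hv ⊢
    constructor
    · rintro ⟨e, he | he, hve⟩
      · obtain ⟨g, hg, hvg⟩ := hv.1 ⟨e, he, hve⟩
        exact ⟨g, hs hg, hvg⟩
      · exact ⟨e, he.1, hve⟩
    · rintro ⟨e, he, hve⟩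
      by_cases h0 : e ∈ M0
      · obtain ⟨g, hg, hvg⟩ := hv.2 ⟨e, h0, hve⟩
        exact ⟨g, Or.inl hg, hvg⟩
      · exact ⟨e, Or.inr ⟨he, h0⟩, hve⟩

section emb
variable {V1 V2 : Type*} {G1 : SimpleGraph V1} {G2 : SimpleGraph V2}

theorem covered_map (f : V1 ↪ V2) (M : Finset (Sym2 V1)) :
    covered (M.map f.sym2Map) = f '' covered M := by
  ext v
  simp only [covered, Set.mem_ofPred_eq, Finset.mem_map, Set.mem_image, Function.Embedding.sym2Map_apply]
  constructor
  · rintro ⟨_, ⟨e, he, rfl⟩, hv⟩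
    obtain ⟨x, hx, rfl⟩ := Sym2.mem_map.1 hv
    exact ⟨x, ⟨e, he, hx⟩, rfl⟩
  · rintro ⟨x, ⟨e, he, hx⟩, rfl⟩
    exact ⟨_, ⟨e, he, rfl⟩, Sym2.mem_map.2 ⟨x, hx, rfl⟩⟩

theorem edge_map_iff (f : G1 ↪g G2) (e : Sym2 V1) :
    f.toEmbedding.sym2Map e ∈ G2.edgeSet ↔ e ∈ G1.edgeSet := by
  induction e using Sym2.ind with
  | _ x y => simp [Function.Embedding.sym2Map_apply]

theorem matching_map_iff (f : G1 ↪g G2) (M : Finset (Sym2 V1)) :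
    IsMatchingSet G2 (M.map f.toEmbedding.sym2Map) ↔ IsMatchingSet G1 M := by
  constructor
  · rintro ⟨h1, h2⟩
    refine ⟨fun e he => (edge_map_iff f e).1 (h1 _ (Finset.mem_map_of_mem _ he)), ?_⟩
    intro e he g hg hne v hv hvg
    refine h2 _ (Finset.mem_map_of_mem _ he) _ (Finset.mem_map_of_mem _ hg)
      (fun h => hne (f.toEmbedding.sym2Map.injective h)) (f v) ?_ ?_
    · exact Sym2.mem_map.2 ⟨v, hv, rfl⟩
    · exact Sym2.mem_map.2 ⟨v, hvg, rfl⟩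
  · rintro ⟨h1, h2⟩
    refine ⟨?_, ?_⟩
    · intro e he
      obtain ⟨e, he1, rfl⟩ := Finset.mem_map.1 he
      exact (edge_map_iff f e).2 (h1 e he1)
    · intro e he g hg hne v hv hvg
      obtain ⟨e, he1, rfl⟩ := Finset.mem_map.1 he
      obtain ⟨g, hg1, rfl⟩ := Finset.mem_map.1 hg
      obtain ⟨x, hx, rfl⟩ := Sym2.mem_map.1 hv
      obtain ⟨y, hy, hxy⟩ := Sym2.mem_map.1 hvg
      have : y = x := f.injective hxy
      subst this
      exact h2 e he1 g hg1 (fun h => hne (by rw [h])) y hx hy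

theorem pull_set (f : V1 ↪ V2) (M : Finset (Sym2 V2)) (hM : covered M ⊆ Set.range f) :
    ∃ M1 : Finset (Sym2 V1), M1.map f.sym2Map = M := by
  classical
  refine ⟨M.preimage f.sym2Map f.sym2Map.injective.injOn, ?_⟩
  ext e
  simp only [Finset.mem_map, Finset.mem_preimage]
  constructor
  · rintro ⟨g, hg, rfl⟩; exact hg
  · intro he
    induction e using Sym2.ind with
    | _ x y =>
      obtain ⟨a, rfl⟩ := hM ⟨_, he, Sym2.mem_mk_left x y⟩
      obtain ⟨b, rfl⟩ := hM ⟨_, he, Sym2.mem_mk_right _ y⟩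
      exact ⟨s(a, b), by simpa [Function.Embedding.sym2Map_apply] using he, by simp [Function.Embedding.sym2Map_apply]⟩

theorem ur_map_iff (f : G1 ↪g G2) (M : Finset (Sym2 V1)) :
    IsURMatching G2 (M.map f.toEmbedding.sym2Map) ↔ IsURMatching G1 M := by
  constructor
  · rintro ⟨h1, h2⟩
    refine ⟨(matching_map_iff f M).1 h1, fun M' hM' hc => ?_⟩
    have := h2 (M'.map f.toEmbedding.sym2Map) ((matching_map_iff f M').2 hM')
      (by rw [covered_map, covered_map, hc])
    exact Finset.map_injective _ this
  · rintro ⟨h1, h2⟩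
    refine ⟨(matching_map_iff f M).2 h1, fun M' hM' hc => ?_⟩
    obtain ⟨M1, rfl⟩ := pull_set f.toEmbedding M' (by rw [hc, covered_map]; exact Set.image_subset_range _ _)
    rw [h2 M1 ((matching_map_iff f M1).1 hM') ?_]
    rw [covered_map, covered_map] at hc
    exact f.injective.image_injective hc

end emb

/-- abstract block facts -/
def BlockFact {U : Type*} (G : SimpleGraph U) (k : ℕ) : Prop :=
  (∀ M, IsURMatching G M → M.card ≤ k) ∧
  ∀ Y : Set U, Y.ncard ≤ 2 → Y.Finite → (∀ y ∈ Y, (G.neighborSet y).ncard = 2) →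
    ∃ M, IsURMatching G M ∧ M.card = k ∧ ∀ y ∈ Y, y ∉ covered M

theorem BlockFact.iso {U U' : Type*} {G : SimpleGraph U} {G' : SimpleGraph U'} {k : ℕ}
    (f : G ≃g G') (h : BlockFact G' k) : BlockFact G k := by
  refine ⟨fun M hM => ?_, fun Y hY hf hd => ?_⟩
  · have := h.1 _ ((ur_map_iff f.toEmbedding M).2 hM)
    simpa using this
  · obtain ⟨M, hM, hk, hc⟩ := h.2 (f '' Y) (by rw [Set.ncard_image_of_injective _ f.injective]; exact hY)
      (hf.image _) (by
        rintro _ ⟨y, hy, rfl⟩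
        rw [← hd y hy, ← Set.ncard_image_of_injective _ f.injective]
        congr 1
        ext z
        simp only [mem_neighborSet, Set.mem_image]
        constructor
        · intro h
          refine ⟨f.symm z, ?_, by simp⟩
          rw [← f.map_adj_iff]; simpa using h
        · rintro ⟨x, hx, rfl⟩
          exact f.map_adj_iff.2 hx)
    refine ⟨M.map f.symm.toEmbedding.toEmbedding.sym2Map, (ur_map_iff f.symm.toEmbedding M).2 hM, by simpa using hk, ?_⟩
    intro y hy hcov
    rw [covered_map] at hcov
    obtain ⟨x, hx, hxy⟩ := hcov
    refine hc (f y) ⟨y, hy, rfl⟩ ?_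
    have : x = f y := by rw [← hxy]; simp
    rwa [← this]



/-- In a bipartite graph (with `P` one side), a nonempty uniquely restricted matching has an edge
`ab` such that `b` is the only covered neighbour of `a`. -/
theorem ur_peel {V : Type*} {G : SimpleGraph V} {P : V → Prop}
    (hb : ∀ a b, G.Adj a b → (P a ↔ ¬ P b)) {M : Finset (Sym2 V)} (hM : IsURMatching G M)
    (hne : M.Nonempty) :
    ∃ a b, P a ∧ s(a, b) ∈ M ∧ ∀ c ∈ covered M, G.Adj a c → c = b := by
  classical
  by_contra hcon
  push Not at hcon
  have hrep : ∀ e : M, ∃ a b, P a ∧ ¬ P b ∧ (e : Sym2 V) = s(a, b) ∧ G.Adj a b := by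
    rintro ⟨e, he⟩
    have h1 := hM.1.1 e he
    induction e using Sym2.ind with
    | _ x y =>
      have h2 : G.Adj x y := h1
      by_cases hx : P x
      · exact ⟨x, y, hx, (hb _ _ h2).1 hx, rfl, h2⟩
      · exact ⟨y, x, (hb _ _ h2.symm).2 hx, hx, Sym2.eq_swap, h2.symm⟩
  choose a b hPa hPb hab hadj using hrep
  have same : ∀ e f : M, ∀ v, v ∈ (e : Sym2 V) → v ∈ (f : Sym2 V) → e = f := by
    intro e f v he hf
    by_contra hh
    exact hM.1.2 e e.2 f f.2 (fun h => hh (Subtype.ext h)) v he hf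
  have ainj : Function.Injective a := fun e f h => same e f (a e) (by rw [hab e]; simp) (by rw [hab f, h]; simp)
  have binj : Function.Injective b := fun e f h => same e f (b e) (by rw [hab e]; simp) (by rw [hab f, h]; simp)
  have hF : ∀ e : M, ∃ f : M, G.Adj (a e) (b f) ∧ f ≠ e := by
    intro e
    obtain ⟨c, ⟨g, hg, hcg⟩, hac, hcb⟩ := hcon (a e) (b e) (hPa e) (by rw [← hab e]; exact e.2)
    have hc : ¬ P c := (hb _ _ hac).1 (hPa e)
    have := hab ⟨g, hg⟩
    simp only at this
    rw [this] at hcg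
    rcases Sym2.mem_iff.1 hcg with h | h
    · exact absurd (hPa ⟨g, hg⟩) (h ▸ hc)
    · exact ⟨⟨g, hg⟩, h ▸ hac, fun hh => hcb (by rw [h, hh])⟩
  choose F hF1 hF2 using hF
  let σ : M → M := fun e => if e ∈ Function.periodicPts F then F e else e
  have hσinj : Function.Injective σ := by
    have hbij := Function.bijOn_periodicPts F
    intro e f hef
    simp only [σ] at hef
    split_ifs at hef with h1 h2 h2
    · exact hbij.injOn h1 h2 hef
    · exact absurd (hef ▸ hbij.mapsTo h1) h2
    · exact absurd (hef ▸ hbij.mapsTo h2) h1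
    · exact hef
  have hσsurj : Function.Surjective σ := Finite.surjective_of_injective hσinj
  have hσadj : ∀ e, G.Adj (a e) (b (σ e)) := by
    intro e
    simp only [σ]
    split_ifs
    · exact hF1 e
    · exact hadj e
  have hper : ∃ e, e ∈ Function.periodicPts F := by
    obtain ⟨e, he⟩ := hne
    obtain ⟨m, n, hmn, h⟩ := Finite.exists_ne_map_eq_of_infinite (fun n : ℕ => F^[n] ⟨e, he⟩)
    wlog hlt : m < n generalizing m n
    · exact this n m hmn.symm h.symm (by omega)
    refine ⟨F^[m] ⟨e, he⟩, Function.mk_mem_periodicPts (n := n - m) (by omega) ?_⟩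
    rw [Function.IsPeriodicPt, Function.IsFixedPt, ← Function.iterate_add_apply, Nat.sub_add_cancel hlt.le, h]
  obtain ⟨e0, he0⟩ := hper
  let M' : Finset (Sym2 V) := Finset.univ.image (fun e : M => s(a e, b (σ e)))
  have hM' : IsMatchingSet G M' := by
    refine ⟨?_, ?_⟩
    · intro e he
      obtain ⟨e, -, rfl⟩ := Finset.mem_image.1 he
      exact hσadj e
    · intro e he f hf hef v hv hvf
      obtain ⟨e, -, rfl⟩ := Finset.mem_image.1 he
      obtain ⟨f, -, rfl⟩ := Finset.mem_image.1 hf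
      have hne' : e ≠ f := fun h => hef (by rw [h])
      rcases Sym2.mem_iff.1 hv with h1 | h1 <;> rcases Sym2.mem_iff.1 hvf with h2 | h2
      · exact hne' (ainj (h1 ▸ h2))
      · exact hPb (σ f) (h2 ▸ h1 ▸ hPa e)
      · exact hPb (σ e) (h1 ▸ h2 ▸ hPa f)
      · exact hne' (hσinj (binj (h1 ▸ h2)))
  have hcov : covered M' = covered M := by
    ext v
    constructor
    · rintro ⟨e, he, hv⟩
      obtain ⟨e, -, rfl⟩ := Finset.mem_image.1 he
      rcases Sym2.mem_iff.1 hv with h | h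
      · exact ⟨e, e.2, by rw [hab e, h]; simp⟩
      · exact ⟨σ e, (σ e).2, by rw [hab (σ e), h]; simp⟩
    · rintro ⟨e, he, hv⟩
      have h0 := hab ⟨e, he⟩
      simp only at h0
      rw [h0] at hv
      rcases Sym2.mem_iff.1 hv with h | h
      · exact ⟨_, Finset.mem_image.2 ⟨⟨e, he⟩, Finset.mem_univ _, rfl⟩, by rw [h]; simp⟩
      · obtain ⟨f, hf⟩ := hσsurj ⟨e, he⟩
        exact ⟨_, Finset.mem_image.2 ⟨f, Finset.mem_univ _, rfl⟩, by rw [h, hf]; simp⟩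
  have hEq := hM.2 M' hM' hcov
  have hmem : s(a e0, b (σ e0)) ∈ M := by
    rw [← hEq]; exact Finset.mem_image.2 ⟨e0, Finset.mem_univ _, rfl⟩
  have h1 := same ⟨_, hmem⟩ e0 (a e0) (by simp) (by rw [hab e0]; simp)
  have h2 : b (σ e0) ∈ (e0 : Sym2 V) := by
    have hh : s(a e0, b (σ e0)) = (e0 : Sym2 V) := congrArg Subtype.val h1
    have h := Sym2.mem_mk_right (a e0) (b (σ e0))
    exact (congrArg (fun z => b (σ e0) ∈ z) hh).mp h
  rw [hab e0] at h2
  rcases Sym2.mem_iff.1 h2 with h | h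
  · exact hPb _ (h ▸ hPa e0)
  · have h3 := binj h
    simp only [σ, if_pos he0] at h3
    exact hF2 e0 h3

/-- Peeling lists give uniquely restricted matchings. -/
theorem ur_cons {V : Type*} [DecidableEq V] {G : SimpleGraph V} {M : Finset (Sym2 V)} (hM : IsURMatching G M)
    {a b : V} (hab : G.Adj a b) (ha : a ∉ covered M) (hb : b ∉ covered M)
    (hp : ∀ c ∈ covered M, ¬ G.Adj b c) :
    IsURMatching G (insert s(a, b) M) ∧ (insert s(a, b) M).card = M.card + 1 ∧
      ∀ v, v ∈ covered (insert s(a, b) M) ↔ v = a ∨ v = b ∨ v ∈ covered M := by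
  have hcov : ∀ v, v ∈ covered (insert s(a, b) M) ↔ v = a ∨ v = b ∨ v ∈ covered M := by
    intro v
    simp [covered, or_assoc]
  have hnot : s(a, b) ∉ M := fun h => ha ⟨_, h, by simp⟩
  have hmat : IsMatchingSet G (insert s(a, b) M) := by
    refine ⟨?_, ?_⟩
    · intro e he
      rcases Finset.mem_insert.1 he with rfl | he
      · exact hab
      · exact hM.1.1 e he
    · intro e he f hf hne v hv hvf
      rcases Finset.mem_insert.1 he with rfl | he1 <;> rcases Finset.mem_insert.1 hf with rfl | hf1
      · exact hne rfl
      · rcases Sym2.mem_iff.1 hv with rfl | rfl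
        · exact ha ⟨f, hf1, hvf⟩
        · exact hb ⟨f, hf1, hvf⟩
      · rcases Sym2.mem_iff.1 hvf with rfl | rfl
        · exact ha ⟨e, he1, hv⟩
        · exact hb ⟨e, he1, hv⟩
      · exact hM.1.2 e he1 f hf1 hne v hv hvf
  refine ⟨⟨hmat, ?_⟩, Finset.card_insert_of_notMem hnot, hcov⟩
  intro M' hM' hc
  have hbM' : b ∈ covered M' := by rw [hc, hcov]; simp
  obtain ⟨e, he, hbe⟩ := hbM'
  obtain ⟨c, rfl⟩ := Sym2.mem_iff_exists.1 hbe
  have hbc : G.Adj b c := hM'.1 _ he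
  have hcM' : c ∈ covered M' := ⟨_, he, by simp⟩
  have hca : c = a := by
    rw [hc, hcov] at hcM'
    rcases hcM' with h | h | h
    · exact h
    · exact absurd hbc (by rw [h]; exact G.loopless.irrefl b)
    · exact absurd hbc (hp c h)
  subst hca
  rw [Sym2.eq_swap] at he
  have key : M'.erase s(c, b) = M := by
    apply hM.2
    · exact ⟨fun e he => hM'.1 e (Finset.mem_of_mem_erase he),
        fun e he f hf => hM'.2 e (Finset.mem_of_mem_erase he) f (Finset.mem_of_mem_erase hf)⟩
    · ext v
      constructor
      · rintro ⟨g, hg, hvg⟩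
        have hvM' : v ∈ covered M' := ⟨g, Finset.mem_of_mem_erase hg, hvg⟩
        have hd := hM'.2 g (Finset.mem_of_mem_erase hg) _ he (Finset.ne_of_mem_erase hg) v hvg
        rw [hc, hcov] at hvM'
        rcases hvM' with h | h | h
        · exact absurd (by simp [h]) hd
        · exact absurd (by simp [h]) hd
        · exact h
      · intro hv
        have hvM' : v ∈ covered M' := by rw [hc, hcov]; exact Or.inr (Or.inr hv)
        obtain ⟨g, hg, hvg⟩ := hvM'
        refine ⟨g, Finset.mem_erase.2 ⟨?_, hg⟩, hvg⟩
        rintro rfl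
        rcases Sym2.mem_iff.1 hvg with rfl | rfl
        · exact ha hv
        · exact hb hv
  rw [← key, Finset.insert_erase he]



def adjOf (A : List ℕ) (a b : ℕ) : Bool := Nat.testBit (A.getD a 0) b

def findS : List ℕ → ℕ → ℕ
  | [], _ => 0
  | m :: L, c => cond (Nat.beq (Nat.mod 4294967296 (Nat.xor (Nat.lor m c) c)) 0)
      (Nat.xor (Nat.lor m c) c) (findS L c)

def chk (L : List ℕ) : ℕ → ℕ → Bool
  | 0, c => L.all (fun m => Nat.beq (Nat.lor m c) c)
  | k + 1, c => cond (Nat.beq (findS L c) 0)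
      (L.all fun m => Nat.beq (Nat.lor m c) c || chk L k (Nat.lor m c))
      (chk L k (Nat.lor c (findS L c)))

def pk {n : ℕ} (A : List ℕ) : List (Fin n × Fin n) → Bool
  | [] => true
  | p :: l => adjOf A p.1 p.2 && l.all (fun q => q.1 ≠ p.1 && q.2 ≠ p.1 && q.1 ≠ p.2 && q.2 ≠ p.2
      && !adjOf A p.2 q.1 && !adjOf A p.2 q.2) && pk A l

theorem findS_pow (L : List ℕ) (c : ℕ) : findS L c = 0 ∨ ∃ j, findS L c = 2 ^ j := by
  induction L with
  | nil => exact Or.inl rfl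
  | cons m L ih =>
    rw [findS]
    generalize Nat.xor (Nat.lor m c) c = d
    cases h : Nat.beq (Nat.mod 4294967296 d) 0 with
    | false => simpa using ih
    | true =>
      right
      have h1 : 4294967296 % d = 0 := Nat.eq_of_beq_eq_true h
      have h2 : d ∣ 2 ^ 32 := by norm_num; exact Nat.dvd_of_mod_eq_zero h1
      obtain ⟨j, -, hj⟩ := (Nat.dvd_prime_pow Nat.prime_two).1 h2
      exact ⟨j, by simpa using hj⟩

def Bd {n : ℕ} (G : SimpleGraph (Fin n)) (c k : ℕ) : Prop :=
  ∀ M, IsURMatching G M → (∀ v ∈ covered M, c.testBit (v : Fin n).val = false) → M.card ≤ k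

theorem covered_erase_sub {V : Type*} [DecidableEq V] (M : Finset (Sym2 V)) (e) :
    covered (M.erase e) ⊆ covered M := by
  rintro v ⟨f, hf, hv⟩
  exact ⟨f, Finset.mem_of_mem_erase hf, hv⟩

theorem Bd.single {n : ℕ} {G : SimpleGraph (Fin n)} {c k j : ℕ} (h : Bd G (c ||| 2 ^ j) k) :
    Bd G c (k + 1) := by
  intro M hM hc
  by_cases hj : ∃ v ∈ covered M, v.val = j
  · obtain ⟨v, ⟨e, he, hv⟩, rfl⟩ := hj
    have := h (M.erase e) (ur_subset hM (Finset.erase_subset _ _)) ?_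
    · rw [Finset.card_erase_of_mem he] at this; omega
    · intro u hu
      obtain ⟨f, hf, huf⟩ := hu
      have h1 := hc u (covered_erase_sub M e ⟨f, hf, huf⟩)
      have h2 : u ≠ v := by
        rintro rfl
        exact hM.1.2 f (Finset.mem_of_mem_erase hf) e he (Finset.ne_of_mem_erase hf) u huf hv
      rw [Nat.testBit_or, h1, Nat.testBit_two_pow_of_ne (fun h => h2 (Fin.ext h.symm))]
      rfl
  · have := h M hM ?_
    · omega
    · intro v hv
      rw [Nat.testBit_or, hc v hv, Nat.testBit_two_pow_of_ne (fun h => hj ⟨v, hv, h.symm⟩)]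
      rfl

section
variable {n : ℕ} {G : SimpleGraph (Fin n)} {A : List ℕ} {L : List ℕ} {Pm : ℕ}

theorem Bd.branch (hG : ∀ a b : Fin n, G.Adj a b ↔ adjOf A a b = true)
    (hb : ∀ a b : Fin n, adjOf A a b = true → (Pm.testBit a ↔ ¬ Pm.testBit b))
    (hL : ∀ a : Fin n, Pm.testBit a = true → A.getD a 0 ∈ L) {c : ℕ} {M : Finset (Sym2 (Fin n))}
    (hM : IsURMatching G M) (hc : ∀ v ∈ covered M, c.testBit (v : Fin n).val = false)
    (hne : M.Nonempty) :
    ∃ m ∈ L, m ||| c ≠ c ∧ ∃ e ∈ M, ∀ v ∈ covered (M.erase e), (m ||| c).testBit v.val = false := by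
  obtain ⟨a, b, ha, hab, hp⟩ := ur_peel (P := fun a : Fin n => Pm.testBit a = true)
    (fun a b h => hb a b ((hG a b).1 h)) hM hne
  refine ⟨A.getD a 0, hL a ha, ?_, s(a, b), hab, ?_⟩
  · intro h
    have h1 : adjOf A a b = true := (hG a b).1 (hM.1.1 _ hab)
    have h2 := hc b ⟨_, hab, by simp⟩
    rw [← h, Nat.testBit_or] at h2
    rw [adjOf] at h1
    rw [h1] at h2
    simp at h2
  · intro v hv
    rw [Nat.testBit_or, hc v (covered_erase_sub _ _ hv), Bool.or_false]
    by_contra h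
    have h1 : G.Adj a v := (hG a v).2 (by rw [adjOf]; simpa using h)
    have h2 := hp v (covered_erase_sub _ _ hv) h1
    subst h2
    obtain ⟨f, hf, hvf⟩ := hv
    exact hM.1.2 f (Finset.mem_of_mem_erase hf) _ hab (Finset.ne_of_mem_erase hf) v hvf (by simp)

theorem chk_sound (hG : ∀ a b : Fin n, G.Adj a b ↔ adjOf A a b = true)
    (hb : ∀ a b : Fin n, adjOf A a b = true → (Pm.testBit a ↔ ¬ Pm.testBit b))
    (hL : ∀ a : Fin n, Pm.testBit a = true → A.getD a 0 ∈ L) (k : ℕ) :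
    ∀ c, chk L k c = true → Bd G c k := by
  induction k with
  | zero =>
    intro c h M hM hc
    rcases M.eq_empty_or_nonempty with rfl | hne
    · simp
    · obtain ⟨m, hm, h1, -⟩ := Bd.branch hG hb hL hM hc hne
      rw [chk, List.all_eq_true] at h
      exact absurd (Nat.eq_of_beq_eq_true (h m hm)) h1
  | succ k ih =>
    intro c h
    rw [chk] at h
    cases hs : Nat.beq (findS L c) 0 with
    | false =>
      rw [hs, cond_false] at h
      rcases findS_pow L c with h0 | ⟨j, hj⟩
      · rw [h0] at hs; exact absurd hs (by decide)
      · rw [hj] at h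
        exact Bd.single (ih _ h)
    | true =>
      rw [hs, cond_true, List.all_eq_true] at h
      intro M hM hc
      rcases M.eq_empty_or_nonempty with rfl | hne
      · simp
      · obtain ⟨m, hm, h1, e, he, hcov⟩ := Bd.branch hG hb hL hM hc hne
        have h2 := h m hm
        rw [Bool.or_eq_true] at h2
        rcases h2 with h2 | h2
        · exact absurd (Nat.eq_of_beq_eq_true h2) h1
        · have := ih _ h2 (M.erase e) (ur_subset hM (Finset.erase_subset _ _)) hcov
          rw [Finset.card_erase_of_mem he] at this; omega

theorem pk_sound (hG : ∀ a b : Fin n, G.Adj a b ↔ adjOf A a b = true) (l : List (Fin n × Fin n))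
    (h : pk A l = true) : ∃ M, IsURMatching G M ∧ M.card = l.length ∧
      ∀ v, v ∈ covered M → ∃ p ∈ l, v = p.1 ∨ v = p.2 := by
  induction l with
  | nil =>
    refine ⟨∅, ⟨⟨by simp, by simp⟩, ?_⟩, rfl, by simp [covered]⟩
    intro M' hM' hc
    rw [Finset.eq_empty_iff_forall_notMem]
    intro e he
    induction e using Sym2.ind with
    | _ x y =>
      have : x ∈ covered M' := ⟨_, he, by simp⟩
      rw [hc] at this
      simp [covered] at this
  | cons p l ih =>
    simp only [pk, Bool.and_eq_true, List.all_eq_true, Bool.not_eq_true', decide_eq_true_eq] at h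
    obtain ⟨⟨h1, h2⟩, h3⟩ := h
    obtain ⟨M, hM, hk, hc⟩ := ih h3
    have := ur_cons hM ((hG _ _).2 h1) ?_ ?_ ?_
    · obtain ⟨r1, r2, r3⟩ := this
      refine ⟨_, r1, by rw [r2, hk]; rfl, ?_⟩
      intro v hv
      rcases (r3 v).1 hv with h | h | h
      · exact ⟨p, by simp, Or.inl h⟩
      · exact ⟨p, by simp, Or.inr h⟩
      · obtain ⟨q, hq, hv⟩ := hc v h
        exact ⟨q, by simp [hq], hv⟩
    · intro h
      obtain ⟨q, hq, hv⟩ := hc _ h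
      have := h2 q hq
      grind
    · intro h
      obtain ⟨q, hq, hv⟩ := hc _ h
      have := h2 q hq
      grind
    · intro c h hadj
      obtain ⟨q, hq, hv⟩ := hc _ h
      have := h2 q hq
      rw [hG] at hadj
      grind

theorem block_of_check (hG : ∀ a b : Fin n, G.Adj a b ↔ adjOf A a b = true)
    (hb : ∀ a b : Fin n, adjOf A a b = true → (Pm.testBit a ↔ ¬ Pm.testBit b))
    (hL : ∀ a : Fin n, Pm.testBit a = true → A.getD a 0 ∈ L) (k : ℕ)
    (hchk : chk L k 0 = true) (y0 : Fin n) (d2 : List (Fin n)) (hy0 : y0 ∈ d2)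
    (hd2 : ∀ y : Fin n, y ∉ d2 → (Finset.univ.filter (fun b : Fin n => adjOf A y b = true)).card ≠ 2)
    (certs : List (List (Fin n × Fin n)))
    (hcert : ∀ y1 ∈ d2, ∀ y2 ∈ d2, ∃ l ∈ certs, (∀ p ∈ l, p.1 ≠ y1 ∧ p.2 ≠ y1 ∧ p.1 ≠ y2 ∧ p.2 ≠ y2)
      ∧ l.length = k ∧ pk A l = true) :
    BlockFact G k := by
  refine ⟨fun M hM => chk_sound hG hb hL k 0 hchk M hM (by simp), ?_⟩
  intro Y hY hfin hdeg
  have hYd : ∀ y ∈ Y, y ∈ d2 := by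
    intro y hy
    by_contra h
    apply hd2 y h
    rw [← hdeg y hy, ← Set.ncard_coe_finset]
    congr 1
    ext b
    simp [hG]
  have : ∃ y1 ∈ d2, ∃ y2 ∈ d2, ∀ y ∈ Y, y = y1 ∨ y = y2 := by
    have h3 : Y.ncard = 0 ∨ Y.ncard = 1 ∨ Y.ncard = 2 := by omega
    rcases h3 with h | h | h
    · rw [Set.ncard_eq_zero] at h
      exact ⟨y0, hy0, y0, hy0, by simp [h]⟩
    · obtain ⟨a, rfl⟩ := Set.ncard_eq_one.1 h
      exact ⟨a, hYd a (by simp), a, hYd a (by simp), by simp⟩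
    · obtain ⟨a, b, -, rfl⟩ := Set.ncard_eq_two.1 h
      exact ⟨a, hYd a (by simp), b, hYd b (by simp), by simp⟩
  obtain ⟨y1, h1, y2, h2, hsub⟩ := this
  obtain ⟨l, -, hl, hk, hpk⟩ := hcert y1 h1 y2 h2
  obtain ⟨M, hM, hc, hcov⟩ := pk_sound hG l hpk
  refine ⟨M, hM, by rw [hc, hk], ?_⟩
  intro y hy hyc
  obtain ⟨p, hp, hv⟩ := hcov y hyc
  have := hl p hp
  have := hsub y hy
  grind
end


set_option synthInstance.maxSize 100000 in
set_option synthInstance.maxHeartbeats 1000000 in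
set_option maxRecDepth 100000 in
theorem bf1 : BlockFact BG1 3 := by
  refine block_of_check (A := [112, 400, 672, 832, 3, 5, 9, 6, 10, 12])
    (L := [3, 5, 9, 6, 10, 12]) (Pm := 1008) ?_ (by decide +kernel) (by decide +kernel) 3 (by decide +kernel)
    4 [4, 5, 6, 7, 8, 9] (by decide +kernel) (by decide +kernel)
    [[(1, 7), (3, 8), (0, 6)], [(2, 9), (1, 8), (0, 5)], [(2, 5), (3, 6), (1, 7)], [(2, 9), (1, 7), (0, 4)], [(1, 4), (3, 6), (2, 9)], [(0, 4), (2, 5), (3, 8)]] (by decide +kernel)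
  simp only [BG1, fromEdgeSet_adj, Set.mem_insert_iff, Set.mem_singleton_iff, Sym2.eq_iff]
  decide +kernel

set_option synthInstance.maxSize 100000 in
set_option synthInstance.maxHeartbeats 1000000 in
set_option maxRecDepth 100000 in
theorem bf2 : BlockFact BG2 4 := by
  refine block_of_check (A := [112, 400, 672, 832, 4099, 2053, 1033, 1030, 2058, 4108, 192, 288, 528])
    (L := [112, 400, 672, 832, 192, 288, 528]) (Pm := 7183) ?_ (by decide +kernel) (by decide +kernel) 4 (by decide +kernel)
    10 [10, 11, 12] (by decide +kernel) (by decide +kernel)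
    [[(0, 5), (3, 6), (12, 9), (1, 7)], [(0, 6), (1, 4), (11, 8), (2, 9)], [(1, 8), (0, 4), (10, 6), (2, 7)]] (by decide +kernel)
  simp only [BG2, fromEdgeSet_adj, Set.mem_insert_iff, Set.mem_singleton_iff, Sym2.eq_iff]
  decide +kernel

set_option synthInstance.maxSize 100000 in
set_option synthInstance.maxHeartbeats 1000000 in
set_option maxRecDepth 100000 in
theorem bf3 : BlockFact BG3 5 := by
  refine block_of_check (A := [4130, 5, 8202, 20, 16424, 17, 6272, 320, 8832, 1280, 18944, 1088, 32833, 33028, 33808, 28672])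
    (L := [5, 20, 17, 320, 1280, 1088, 32833, 33028, 33808]) (Pm := 31402) ?_ (by decide +kernel) (by decide +kernel) 5 (by decide +kernel)
    1 [1, 3, 5, 7, 9, 11] (by decide +kernel) (by decide +kernel)
    [[(6, 7), (10, 11), (15, 14), (0, 12), (2, 13)], [(4, 5), (15, 14), (6, 12), (8, 9), (2, 13)], [(4, 3), (15, 14), (8, 13), (0, 1), (6, 12)]] (by decide +kernel)
  simp only [BG3, fromEdgeSet_adj, Set.mem_insert_iff, Set.mem_singleton_iff, Sym2.eq_iff]
  decide +kernel

set_option synthInstance.maxSize 100000 in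
set_option synthInstance.maxHeartbeats 1000000 in
set_option maxRecDepth 100000 in
theorem bf4 : BlockFact BG4 6 := by
  refine block_of_check (A := [4130, 8197, 16394, 32788, 65576, 131089, 6272, 8512, 17024, 34048, 68096, 132160, 262209, 130, 262404, 520, 263184, 2080, 86016])
    (L := [4130, 16394, 65576, 6272, 17024, 68096, 130, 520, 2080, 86016]) (Pm := 435541) ?_ (by decide +kernel) (by decide +kernel) 6 (by decide +kernel)
    13 [13, 15, 17] (by decide +kernel) (by decide +kernel)
    [[(2, 14), (10, 9), (4, 16), (0, 1), (17, 5), (6, 12)], [(4, 16), (6, 11), (8, 7), (2, 14), (15, 9), (0, 12)], [(2, 3), (18, 14), (10, 16), (6, 11), (0, 5), (13, 1)]] (by decide +kernel)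
  simp only [BG4, fromEdgeSet_adj, Set.mem_insert_iff, Set.mem_singleton_iff, Sym2.eq_iff]
  decide +kernel

set_option synthInstance.maxSize 100000 in
set_option synthInstance.maxHeartbeats 1000000 in
set_option maxRecDepth 100000 in
theorem bf5 : BlockFact BG5 5 := by
  refine block_of_check (A := [112, 400, 672, 832, 4099, 2053, 1033, 1030, 2058, 4108, 8384, 8480, 33296, 19456, 40960, 20480])
    (L := [112, 400, 672, 832, 8384, 8480, 33296, 40960]) (Pm := 23567) ?_ (by decide +kernel) (by decide +kernel) 5 (by decide +kernel)
    14 [14, 15] (by decide +kernel) (by decide +kernel)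
    [[(11, 13), (0, 6), (1, 8), (12, 4), (2, 9)]] (by decide +kernel)
  simp only [BG5, fromEdgeSet_adj, Set.mem_insert_iff, Set.mem_singleton_iff, Sym2.eq_iff]
  decide +kernel

set_option synthInstance.maxSize 100000 in
set_option synthInstance.maxHeartbeats 1000000 in
set_option maxRecDepth 100000 in
theorem bf6 : BlockFact BG6 6 := by
  refine block_of_check (A := [112, 400, 672, 832, 4099, 2053, 1033, 1030, 2058, 4108, 8384, 33056, 131600, 279552, 40960, 83968, 163840, 331776, 139264])
    (L := [112, 400, 672, 832, 8384, 33056, 131600, 40960, 163840, 139264]) (Pm := 351247) ?_ (by decide +kernel) (by decide +kernel) 6 (by decide +kernel)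
    14 [14, 16, 18] (by decide +kernel) (by decide +kernel)
    [[(10, 13), (12, 17), (3, 6), (1, 4), (2, 9), (11, 8)]] (by decide +kernel)
  simp only [BG6, fromEdgeSet_adj, Set.mem_insert_iff, Set.mem_singleton_iff, Sym2.eq_iff]
  decide +kernel

set_option synthInstance.maxSize 100000 in
set_option synthInstance.maxHeartbeats 1000000 in
set_option maxRecDepth 100000 in
theorem bf7 : BlockFact BG7 6 := by
  refine block_of_check (A := [4130, 5, 8202, 262164, 16424, 131089, 6272, 320, 8832, 132352, 18944, 263232, 32833, 33028, 33808, 28672, 393216, 66080, 67592])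
    (L := [5, 262164, 131089, 320, 132352, 263232, 32833, 33028, 33808, 393216]) (Pm := 96938) ?_ (by decide +kernel) (by decide +kernel) 6 (by decide +kernel)
    1 [1, 7, 16] (by decide +kernel) (by decide +kernel)
    [[(10, 14), (2, 3), (6, 11), (0, 12), (8, 13), (17, 5)]] (by decide +kernel)
  simp only [BG7, fromEdgeSet_adj, Set.mem_insert_iff, Set.mem_singleton_iff, Sym2.eq_iff]
  decide +kernel

set_option synthInstance.maxSize 100000 in
set_option synthInstance.maxHeartbeats 1000000 in
set_option maxRecDepth 100000 in
theorem bf8 : BlockFact BG8 7 := by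
  refine block_of_check (A := [4130, 8197, 16394, 32788, 65576, 131089, 6272, 8512, 17024, 34048, 68096, 132160, 262209, 524418, 262404, 524808, 263184, 2099232, 86016, 1089536, 2621440, 1179648])
    (L := [4130, 16394, 65576, 6272, 17024, 68096, 524418, 524808, 2099232, 86016, 2621440]) (Pm := 1484117) ?_ (by decide +kernel) (by decide +kernel) 7 (by decide +kernel)
    20 [20, 21] (by decide +kernel) (by decide +kernel)
    [[(4, 16), (15, 9), (2, 14), (13, 19), (0, 1), (17, 5), (6, 12)]] (by decide +kernel)
  simp only [BG8, fromEdgeSet_adj, Set.mem_insert_iff, Set.mem_singleton_iff, Sym2.eq_iff]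
  decide +kernel

set_option synthInstance.maxSize 100000 in
set_option synthInstance.maxHeartbeats 1000000 in
set_option maxRecDepth 100000 in
theorem bf9 : BlockFact BG9 8 := by
  refine block_of_check (A := [4130, 8197, 16394, 32788, 65576, 131089, 6272, 8512, 17024, 34048, 68096, 132160, 262209, 524418, 262404, 2097672, 263184, 8390688, 86016, 17833984, 2621440, 5275648, 10485760, 21102592, 8912896])
    (L := [4130, 16394, 65576, 6272, 17024, 68096, 524418, 2097672, 8390688, 86016, 2621440, 10485760, 8912896]) (Pm := 22455637) ?_ (by decide +kernel) (by decide +kernel) 8 (by decide +kernel)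
    20 [20, 22, 24] (by decide +kernel) (by decide +kernel)
    [[(17, 23), (6, 11), (13, 19), (8, 7), (18, 16), (2, 14), (0, 1), (15, 21)]] (by decide +kernel)
  simp only [BG9, fromEdgeSet_adj, Set.mem_insert_iff, Set.mem_singleton_iff, Sym2.eq_iff]
  decide +kernel



theorem forest_card {V : Type*} [Fintype V] {T : SimpleGraph V} (hT : T.IsAcyclic) (s : Finset V)
    (hs : s.Nonempty) (E : Finset (Sym2 V)) (hE : ∀ e ∈ E, e ∈ T.edgeSet ∧ ∀ v ∈ e, v ∈ s) :
    E.card + 1 ≤ s.card := by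
  classical
  have hne : Nonempty (s : Set V) := ⟨⟨_, hs.choose_spec⟩⟩
  have hac := hT.induce (s : Set V)
  have htop : (⊤ : SimpleGraph (s : Set V)).Connected := connected_top
  obtain ⟨H, hH1, hH2, hH3⟩ := htop.exists_isTree_le_of_le_of_isAcyclic le_top hac
  have h1 := hH3.card_edgeFinset
  obtain ⟨E1, hE1⟩ := pull_set (Function.Embedding.subtype (fun x => x ∈ (s : Set V))) E (by
    rintro v ⟨e, he, hv⟩
    exact ⟨⟨v, (hE e he).2 v hv⟩, rfl⟩)
  have h2 : E1 ⊆ H.edgeFinset := by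
    intro e he
    rw [mem_edgeFinset]
    apply edgeSet_mono hH1
    have := (hE (Sym2.map Subtype.val e) (by
      rw [← hE1]; exact Finset.mem_map_of_mem _ he)).1
    induction e with
    | _ x y => simpa using this
  have h3 := Finset.card_le_card h2
  rw [← hE1, Finset.card_map]
  have h4 : Fintype.card (s : Set V) = s.card := by simp
  omega

open Classical in
noncomputable def Nb {V : Type*} (T : SimpleGraph V) (Z I : Finset V) : Finset V :=
  I.filter (fun x => ∃ z ∈ Z, T.Adj z x)

theorem mem_Nb {V : Type*} {T : SimpleGraph V} {Z I : Finset V} {x : V} :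
    x ∈ Nb T Z I ↔ x ∈ I ∧ ∃ z ∈ Z, T.Adj z x := by
  simp [Nb]

def InjM {V : Type*} (T : SimpleGraph V) (K I : Finset V) (f : V → V) : Prop :=
  (∀ k ∈ K, f k ∈ I ∧ T.Adj k (f k)) ∧ Set.InjOn f K

theorem hallFS {V : Type*} {T : SimpleGraph V} {K I : Finset V}
    (h : ∀ Z ⊆ K, Z.card ≤ (Nb T Z I).card) : ∃ f, InjM T K I f := by
  classical
  have := (Finset.all_card_le_biUnion_card_iff_exists_injective
    (fun k : K => I.filter (fun x => T.Adj k x))).1 (by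
      intro s
      have h1 := h (s.map (Function.Embedding.subtype _)) (by
        intro x hx
        simp at hx
        exact hx.1)
      rw [Finset.card_map] at h1
      refine h1.trans (Finset.card_le_card ?_)
      intro x hx
      rw [mem_Nb] at hx
      obtain ⟨hx, z, hz, ha⟩ := hx
      simp at hz
      obtain ⟨hz1, hz2⟩ := hz
      simp only [Finset.mem_biUnion, Finset.mem_filter]
      exact ⟨⟨z, hz1⟩, hz2, hx, ha⟩)
  obtain ⟨f, hf1, hf2⟩ := this
  refine ⟨fun v => if h : v ∈ K then f ⟨v, h⟩ else v, ?_, ?_⟩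
  · intro k hk
    have := hf2 ⟨k, hk⟩
    simp only [hk, dif_pos]
    simpa using this
  · intro a ha b hb hab
    simp only [Finset.mem_coe] at ha hb
    simp only [ha, hb, dif_pos] at hab
    simpa using hf1 hab

theorem konig {V : Type*} [Fintype V] [DecidableEq V] {T : SimpleGraph V} (hT : T.Colorable 2) :
    ∃ (K : Finset V) (f : V → V), (∀ u v, T.Adj u v → u ∈ K ∨ v ∈ K) ∧ InjM T K Kᶜ f := by
  classical
  obtain ⟨c⟩ := hT
  have hex : ∃ n, ∃ K : Finset V, (∀ u v, T.Adj u v → u ∈ K ∨ v ∈ K) ∧ K.card = n :=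
    ⟨_, Finset.univ, by simp, rfl⟩
  obtain ⟨K, hK, hn⟩ := Nat.find_spec hex
  have hmin : ∀ K2 : Finset V, (∀ u v, T.Adj u v → u ∈ K2 ∨ v ∈ K2) → K.card ≤ K2.card := by
    intro K2 h2
    rw [hn]
    exact Nat.find_min' hex ⟨K2, h2, rfl⟩
  suffices h : ∃ f, InjM T K Kᶜ f by
    obtain ⟨f, hf⟩ := h
    exact ⟨K, f, hK, hf⟩
  apply hallFS
  have key : ∀ (i : Fin 2), ∀ Z ⊆ K, (∀ z ∈ Z, c z = i) → Z.card ≤ (Nb T Z Kᶜ).card := by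
    intro i Z hZ hc
    have := hmin ((K \ Z) ∪ Nb T Z Kᶜ) (by
      have h1 : ∀ u v, T.Adj u v → u ∈ K → u ∈ (K \ Z) ∪ Nb T Z Kᶜ ∨ v ∈ (K \ Z) ∪ Nb T Z Kᶜ := by
        intro u v huv hu
        simp only [Finset.mem_union, Finset.mem_sdiff, mem_Nb, Finset.mem_compl]
        have hne : c u ≠ c v := c.valid huv
        by_cases huZ : u ∈ Z
        · right
          by_cases hv : v ∈ K
          · left
            refine ⟨hv, fun hvZ => hne ?_⟩
            rw [hc u huZ, hc v hvZ]
          · exact Or.inr ⟨hv, u, huZ, huv⟩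
        · exact Or.inl (Or.inl ⟨hu, huZ⟩)
      intro u v huv
      rcases hK u v huv with h | h
      · exact h1 u v huv h
      · exact (h1 v u huv.symm h).symm)
    have h2 := Finset.card_union_le (K \ Z) (Nb T Z Kᶜ)
    have h3 := Finset.card_sdiff_add_card_eq_card hZ
    omega
  intro Z hZ
  have h0 := key 0 (Z.filter (fun z => c z = 0)) ((Finset.filter_subset _ _).trans hZ) (by simp)
  have h1 := key 1 (Z.filter (fun z => ¬ c z = 0)) ((Finset.filter_subset _ _).trans hZ) (by
    intro z hz
    have := (Finset.mem_filter.1 hz).2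
    omega)
  have h2 := Finset.card_filter_add_card_filter_not (s := Z) (fun z => c z = 0)
  have h3 : Disjoint (Nb T (Z.filter (fun z => c z = 0)) Kᶜ)
      (Nb T (Z.filter (fun z => ¬ c z = 0)) Kᶜ) := by
    rw [Finset.disjoint_left]
    intro x hx hy
    rw [mem_Nb] at hx hy
    obtain ⟨_, a, ha, hax⟩ := hx
    obtain ⟨_, b, hb, hbx⟩ := hy
    have e1 := c.valid hax
    have e2 := c.valid hbx
    simp only [Finset.mem_filter] at ha hb
    have := ha.2
    have := hb.2
    omega
  have h4 := Finset.card_union_of_disjoint h3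
  have h5 : (Nb T (Z.filter (fun z => c z = 0)) Kᶜ) ∪
      (Nb T (Z.filter (fun z => ¬ c z = 0)) Kᶜ) ⊆ Nb T Z Kᶜ := by
    intro x hx
    simp only [Finset.mem_union, mem_Nb, Finset.mem_filter] at hx ⊢
    rcases hx with ⟨hx, a, ha, hax⟩ | ⟨hx, a, ha, hax⟩
    · exact ⟨hx, a, ha.1, hax⟩
    · exact ⟨hx, a, ha.1, hax⟩
  have h6 := Finset.card_le_card h5
  omega

/-- matching from an injection -/
theorem match_of_inj {V : Type*} [Fintype V] [DecidableEq V] {T : SimpleGraph V} {K : Finset V}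
    {f : V → V} (hf : InjM T K Kᶜ f) :
    ∃ M, IsMatchingSet T M ∧ M.card = K.card ∧ ∀ v, v ∈ covered M → v ∈ K ∨ ∃ k ∈ K, f k = v := by
  have hnk : ∀ k ∈ K, f k ∉ K := fun k hk => Finset.mem_compl.1 (hf.1 k hk).1
  have hinj : Set.InjOn (fun k => s(k, f k)) (K : Set V) := by
    intro a ha b hb hab
    have ha' := hnk a ha
    rcases Sym2.eq_iff.1 hab with h | h
    · exact h.1
    · exact absurd (h.2 ▸ hb) ha'
  refine ⟨K.image (fun k => s(k, f k)), ⟨?_, ?_⟩, Finset.card_image_of_injOn hinj, ?_⟩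
  · intro e he
    obtain ⟨k, hk, rfl⟩ := Finset.mem_image.1 he
    exact (hf.1 k hk).2
  · intro e he e' he' hne v hv hv'
    obtain ⟨k, hk, rfl⟩ := Finset.mem_image.1 he
    obtain ⟨k', hk', rfl⟩ := Finset.mem_image.1 he'
    apply hne
    rw [Sym2.mem_iff] at hv hv'
    have : k = k' := by
      rcases hv with rfl | rfl <;> rcases hv' with h | h
      · exact h
      · exact absurd (h ▸ hk) (hnk k' hk')
      · exact absurd (h ▸ hk') (hnk k hk)
      · exact hf.2 hk hk' h
    rw [this]
  · rintro v ⟨e, he, hv⟩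
    obtain ⟨k, hk, rfl⟩ := Finset.mem_image.1 he
    rcases Sym2.mem_iff.1 hv with rfl | rfl
    · exact Or.inl hk
    · exact Or.inr ⟨k, hk, rfl⟩

/-- matchings against a cover -/
theorem cover_match {V : Type*} [Nonempty V] [Fintype V] [DecidableEq V] {T : SimpleGraph V} {K : Finset V}
    (hK : ∀ u v, T.Adj u v → u ∈ K ∨ v ∈ K) {M : Finset (Sym2 V)} (hM : IsMatchingSet T M) :
    M.card ≤ K.card ∧ (M.card = K.card → ∃ f, InjM T K Kᶜ f ∧
      ∀ k ∈ K, k ∈ covered M ∧ f k ∈ covered M) := by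
  classical
  have hch : ∀ e ∈ M, ∃ k, k ∈ K ∧ k ∈ e := by
    intro e he
    have := hM.1 e he
    induction e with
    | _ x y =>
      rcases hK x y this with h | h
      · exact ⟨x, h, by simp⟩
      · exact ⟨y, h, by simp⟩
  choose! c hc1 hc2 using hch
  have hinj : Set.InjOn c (M : Set (Sym2 V)) := by
    intro a ha b hb hab
    by_contra hne
    exact hM.2 a ha b hb hne (c a) (hc2 a ha) (hab ▸ hc2 b hb)
  have him : M.image c ⊆ K := by
    intro k hk
    obtain ⟨e, he, rfl⟩ := Finset.mem_image.1 hk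
    exact hc1 e he
  have hci := Finset.card_image_of_injOn hinj
  refine ⟨hci ▸ Finset.card_le_card him, fun heq => ?_⟩
  have himeq : M.image c = K := Finset.eq_of_subset_of_card_le him (by omega)
  have hsur : ∀ k ∈ K, ∃ y, s(k, y) ∈ M ∧ c s(k, y) = k := by
    intro k hk
    rw [← himeq] at hk
    obtain ⟨e, he, hek⟩ := Finset.mem_image.1 hk
    have := hc2 e he
    rw [hek] at this
    obtain ⟨y, rfl⟩ := this
    exact ⟨y, he, hek⟩
  choose! f hf1 hf2 using hsur
  have huniq : ∀ e ∈ M, ∀ e' ∈ M, ∀ v, v ∈ e → v ∈ e' → e = e' := by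
    intro e he e' he' v hv hv'
    by_contra hne
    exact hM.2 e he e' he' hne v hv hv'
  refine ⟨f, ⟨fun k hk => ⟨?_, hM.1 _ (hf1 k hk)⟩, ?_⟩, fun k hk =>
    ⟨⟨_, hf1 k hk, by simp⟩, ⟨_, hf1 k hk, by simp⟩⟩⟩
  · rw [Finset.mem_compl]
    intro hfk
    have h1 := huniq _ (hf1 k hk) _ (hf1 _ hfk) (f k) (by simp) (by simp)
    have h2 := hf2 _ hfk
    rw [← h1, hf2 k hk] at h2
    have h3 : T.Adj k (f k) := hM.1 _ (hf1 k hk)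
    rw [← h2] at h3
    exact T.loopless.irrefl _ h3
  · intro a ha b hb hab
    have h1 := huniq _ (hf1 a ha) _ (hf1 b hb) (f a) (by simp) (by rw [hab]; simp)
    have := hf2 a ha
    rw [h1, hf2 b hb] at this
    exact this.symm



theorem bdd_match {V : Type*} [Fintype V] (T : SimpleGraph V) :
    BddAbove {k | ∃ M : Finset (Sym2 V), IsMatchingSet T M ∧ M.card = k} := by
  classical
  refine ⟨(Finset.univ : Finset (Sym2 V)).card, ?_⟩
  rintro k ⟨M, _, rfl⟩
  exact Finset.card_le_card (Finset.subset_univ _)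

theorem tree_struct {V : Type*} [Fintype V] {T : SimpleGraph V} (hT : MemT T) :
    (∀ u ∈ gallaiD T, ∀ v ∈ gallaiD T, ¬ T.Adj u v) ∧
    ∀ v ∉ gallaiD T, (∀ u, T.Adj v u → u ∈ gallaiD T) ∧ 3 ≤ (T.neighborSet v).ncard := by
  classical
  obtain ⟨hTree, hdeg, hcard⟩ := hT
  have : Nonempty V := hTree.connected.nonempty
  obtain ⟨K, f, hK, hf⟩ := konig hTree.colorable_two
  have hnu : nu T = K.card := by
    obtain ⟨M, hM, hMc, _⟩ := match_of_inj hf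
    apply le_antisymm
    · unfold nu
      refine csSup_le ⟨_, M, hM, rfl⟩ ?_
      rintro k ⟨M', hM', rfl⟩
      exact (cover_match hK hM').1
    · rw [← hMc]
      exact le_csSup (bdd_match T) ⟨M, hM, rfl⟩
  have hD1 : ∀ v ∈ gallaiD T, v ∉ K ∧ ∃ g, InjM T K Kᶜ g ∧ ∀ k ∈ K, g k ≠ v := by
    rintro v ⟨M, hM, hMc, hv⟩
    obtain ⟨g, hg, hgc⟩ := (cover_match hK hM).2 (hMc.trans hnu)
    refine ⟨fun h => hv (hgc v h).1, g, hg, fun k hk h => hv (h ▸ (hgc k hk).2)⟩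
  have hD2 : ∀ v, v ∉ K → ∀ g, InjM T K Kᶜ g → (∀ k ∈ K, g k ≠ v) → v ∈ gallaiD T := by
    intro v hv g hg hgv
    obtain ⟨M, hM, hMc, hMv⟩ := match_of_inj hg
    refine ⟨M, hM, hMc.trans hnu.symm, fun h => ?_⟩
    rcases hMv v h with h | ⟨k, hk, h⟩
    · exact hv h
    · exact hgv k hk h
  have hgZ : ∀ g, InjM T K Kᶜ g → ∀ Z ⊆ K, Z.image g ⊆ Nb T Z Kᶜ ∧ (Z.image g).card = Z.card := by
    intro g hg Z hZ
    constructor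
    · intro x hx
      obtain ⟨z, hz, rfl⟩ := Finset.mem_image.1 hx
      exact mem_Nb.2 ⟨(hg.1 z (hZ hz)).1, z, hz, (hg.1 z (hZ hz)).2⟩
    · exact Finset.card_image_of_injOn (hg.2.mono (by exact_mod_cast hZ))
  -- tight set argument
  have hfA : ∀ a ∈ gallaiA T, f a ∈ gallaiD T := by
    rintro a ⟨haD, d, hd, had⟩
    have hdK := (hD1 d hd).1
    have haK : a ∈ K := (hK a d had).resolve_right hdK
    by_contra hy
    have hyK : f a ∉ K := Finset.mem_compl.1 (hf.1 a haK).1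
    have : ¬ ∀ Z ⊆ K, Z.card ≤ (Nb T Z (Kᶜ.erase (f a))).card := by
      intro h
      obtain ⟨g, hg⟩ := hallFS h
      apply hy
      refine hD2 _ hyK g ⟨fun k hk => ⟨Finset.mem_of_mem_erase (hg.1 k hk).1, (hg.1 k hk).2⟩, hg.2⟩ ?_
      intro k hk h
      have := (hg.1 k hk).1
      rw [h] at this
      simp at this
    push Not at this
    obtain ⟨Z, hZ, hlt⟩ := this
    have herase : Nb T Z (Kᶜ.erase (f a)) = (Nb T Z Kᶜ).erase (f a) := by
      ext x
      simp [mem_Nb, and_assoc]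
    rw [herase] at hlt
    obtain ⟨hf1, hf2⟩ := hgZ f hf Z hZ
    have hf3 := Finset.card_le_card hf1
    have hfaN : f a ∈ Nb T Z Kᶜ := by
      by_contra h
      rw [Finset.erase_eq_of_notMem h] at hlt
      omega
    have hce := Finset.card_erase_of_mem hfaN
    have hfeq : Z.image f = Nb T Z Kᶜ := Finset.eq_of_subset_of_card_le hf1 (by omega)
    have haZ : a ∈ Z := by
      rw [← hfeq] at hfaN
      obtain ⟨z, hz, hza⟩ := Finset.mem_image.1 hfaN
      rwa [← hf.2 (hZ hz) haK hza]
    have hdN : d ∈ Nb T Z Kᶜ := mem_Nb.2 ⟨Finset.mem_compl.2 hdK, a, haZ, had⟩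
    obtain ⟨g, hg, hgd⟩ := (hD1 d hd).2
    obtain ⟨hg1, hg2⟩ := hgZ g hg Z hZ
    have hgeq : Z.image g = Nb T Z Kᶜ := Finset.eq_of_subset_of_card_le hg1 (by omega)
    rw [← hgeq] at hdN
    obtain ⟨z, hz, hzd⟩ := Finset.mem_image.1 hdN
    exact hgd z (hZ hz) hzd
  set A : Finset V := K.filter (fun v => v ∈ gallaiA T) with hAdef
  have hAK : ∀ v, v ∈ gallaiA T → v ∈ A := by
    intro v hv
    obtain ⟨hvD, d, hd, had⟩ := id hv
    exact Finset.mem_filter.2 ⟨(hK v d had).resolve_right (hD1 d hd).1, hv⟩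
  have hAK2 : A ⊆ K := Finset.filter_subset _ _
  set I' : Finset V := Kᶜ.filter (fun v => v ∉ gallaiD T) with hI'
  have hI'K : I' ⊆ (K \ A).image f := by
    intro y hy
    rw [hI', Finset.mem_filter, Finset.mem_compl] at hy
    have : ∃ k ∈ K, f k = y := by
      by_contra h
      push Not at h
      exact hy.2 (hD2 y hy.1 f hf h)
    obtain ⟨k, hk, rfl⟩ := this
    refine Finset.mem_image.2 ⟨k, Finset.mem_sdiff.2 ⟨hk, fun h => hy.2 (hfA k ?_)⟩, rfl⟩
    exact (Finset.mem_filter.1 h).2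
  have hI'c : I'.card ≤ (K \ A).card := (Finset.card_le_card hI'K).trans Finset.card_image_le
  have hinc : ∀ v, (T.incidenceFinset v).card = (T.neighborSet v).ncard := by
    intro v
    rw [card_incidenceFinset_eq_degree, ← card_neighborSet_eq_degree, Set.ncard_eq_toFinset_card',
      Set.toFinset_card]
  have hinc3 : ∀ v ∈ A, (T.incidenceFinset v).card ≤ 3 := fun v hv => by
    rw [hinc]; exact hdeg v (Finset.mem_filter.1 hv).2
  have hE : T.edgeFinset.card = 3 * K.card := by
    have := hTree.card_edgeFinset
    rw [Nat.card_eq_fintype_card] at hcard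
    omega
  have hKA : (K \ A) ∪ I' = ∅ := by
    by_contra hne
    have hne' := Finset.nonempty_iff_ne_empty.2 hne
    have h1 := forest_card hTree.isAcyclic _ hne' (T.edgeFinset.filter (fun e => ∀ v ∈ e, v ∉ A)) (by
      intro e he
      rw [Finset.mem_filter, mem_edgeFinset] at he
      refine ⟨he.1, ?_⟩
      obtain ⟨he1, he2⟩ := he
      have aux : ∀ u v, T.Adj u v → u ∉ A → v ∉ A → u ∈ K → u ∈ K \ A ∪ I' ∧ v ∈ K \ A ∪ I' := by
        intro u v huv hu hv huK
        refine ⟨Finset.mem_union_left _ (Finset.mem_sdiff.2 ⟨huK, hu⟩), ?_⟩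
        by_cases hvK : v ∈ K
        · exact Finset.mem_union_left _ (Finset.mem_sdiff.2 ⟨hvK, hv⟩)
        · refine Finset.mem_union_right _ (Finset.mem_filter.2 ⟨Finset.mem_compl.2 hvK, fun hvD => hu ?_⟩)
          exact hAK u ⟨fun h => (hD1 u h).1 huK, v, hvD, huv⟩
      induction e with
      | _ x y =>
        have hx := he2 x (by simp)
        have hy := he2 y (by simp)
        have hxy : x ∈ K \ A ∪ I' ∧ y ∈ K \ A ∪ I' := by
          rcases hK x y he1 with h | h
          · exact aux x y he1 hx hy h
          · exact (aux y x (T.adj_symm he1) hy hx h).symm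
        intro v hv
        rcases Sym2.mem_iff.1 hv with rfl | rfl
        · exact hxy.1
        · exact hxy.2)
    have h2 : T.edgeFinset ⊆ A.biUnion (fun v => T.incidenceFinset v) ∪
        T.edgeFinset.filter (fun e => ∀ v ∈ e, v ∉ A) := by
      intro e he
      by_cases h : ∀ v ∈ e, v ∉ A
      · exact Finset.mem_union_right _ (Finset.mem_filter.2 ⟨he, h⟩)
      · push Not at h
        obtain ⟨v, hv, hvA⟩ := h
        refine Finset.mem_union_left _ (Finset.mem_biUnion.2 ⟨v, hvA, ?_⟩)
        rw [mem_incidenceFinset]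
        exact ⟨mem_edgeFinset.1 he, hv⟩
    have h3 := (Finset.card_le_card h2).trans (Finset.card_union_le _ _)
    have h4 := Finset.card_biUnion_le_card_mul A (fun v => T.incidenceFinset v) 3 hinc3
    have h5 := Finset.card_union_le (K \ A) I'
    have h6 := Finset.card_sdiff_add_card_eq_card hAK2
    omega
  have hKA1 : ∀ v ∈ K, v ∈ A := by
    intro v hv
    by_contra h
    have : v ∈ (K \ A) ∪ I' := Finset.mem_union_left _ (Finset.mem_sdiff.2 ⟨hv, h⟩)
    rw [hKA] at this
    simp at this
  have hKD : ∀ v, v ∉ K → v ∈ gallaiD T := by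
    intro v hv
    by_contra h
    have : v ∈ (K \ A) ∪ I' := Finset.mem_union_right _ (Finset.mem_filter.2 ⟨Finset.mem_compl.2 hv, h⟩)
    rw [hKA] at this
    simp at this
  refine ⟨fun u hu v hv huv => ?_, fun v hv => ?_⟩
  · rcases hK u v huv with h | h
    · exact (hD1 u hu).1 h
    · exact (hD1 v hv).1 h
  have hvK : v ∈ K := by
    by_contra h
    exact hv (hKD v h)
  have hcl : ∀ F : Finset (Sym2 V),
      T.edgeFinset ⊆ (K.erase v).biUnion (fun v => T.incidenceFinset v) ∪ F → 3 ≤ F.card := by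
    intro F hF
    have h3 := (Finset.card_le_card hF).trans (Finset.card_union_le _ _)
    have h4 := Finset.card_biUnion_le_card_mul (K.erase v) (fun v => T.incidenceFinset v) 3
      (fun x hx => hinc3 x (hKA1 x (Finset.mem_of_mem_erase hx)))
    have h5 := Finset.card_erase_add_one hvK
    omega
  have hEinc : ∀ e ∈ T.edgeFinset, ∃ k ∈ K, e ∈ T.incidenceFinset k := by
    intro e he
    have he' := mem_edgeFinset.1 he
    induction e with
    | _ x y =>
      rcases hK x y he' with h | h
      · exact ⟨x, h, by rw [mem_incidenceFinset]; exact ⟨he', by simp⟩⟩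
      · exact ⟨y, h, by rw [mem_incidenceFinset]; exact ⟨he', by simp⟩⟩
  constructor
  · intro u hvu
    by_contra huD
    have huK : u ∈ K := by
      by_contra h
      exact huD (hKD u h)
    have h1 := hcl ((T.incidenceFinset v).erase s(v, u)) (by
      intro e he
      obtain ⟨k, hk, hek⟩ := hEinc e he
      by_cases hkv : k = v
      · subst hkv
        by_cases h : e = s(k, u)
        · refine Finset.mem_union_left _ (Finset.mem_biUnion.2
            ⟨u, Finset.mem_erase.2 ⟨hvu.ne', huK⟩, ?_⟩)
          rw [mem_incidenceFinset]
          exact ⟨mem_edgeFinset.1 he, by rw [h]; simp⟩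
        · exact Finset.mem_union_right _ (Finset.mem_erase.2 ⟨h, hek⟩)
      · exact Finset.mem_union_left _ (Finset.mem_biUnion.2 ⟨k, Finset.mem_erase.2 ⟨hkv, hk⟩, hek⟩))
    have h2 := hinc3 v (hKA1 v hvK)
    have h3 : s(v, u) ∈ T.incidenceFinset v := by
      rw [mem_incidenceFinset]; exact ⟨hvu, by simp⟩
    have h4 := Finset.card_erase_add_one h3
    omega
  · rw [← hinc]
    apply hcl
    intro e he
    obtain ⟨k, hk, hek⟩ := hEinc e he
    by_cases hkv : k = v
    · subst hkv
      exact Finset.mem_union_right _ hek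
    · exact Finset.mem_union_left _ (Finset.mem_biUnion.2 ⟨k, Finset.mem_erase.2 ⟨hkv, hk⟩, hek⟩)

theorem select {V : Type*} [Fintype V] {T : SimpleGraph V} (hT : T.IsAcyclic) (D : Set V)
    (h : ∀ v ∉ D, (∀ u, T.Adj v u → u ∈ D) ∧ 3 ≤ (T.neighborSet v).ncard)
    (B : Set V) (hB : B.ncard ≤ 2) :
    ∃ g : V → V, (∀ a ∉ D, T.Adj a (g a) ∧ g a ∉ B) ∧
      ∀ a ∉ D, ∀ b ∉ D, g a = g b → a = b := by
  classical
  have hinc : ∀ v, (T.incidenceFinset v).card = (T.neighborSet v).ncard := by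
    intro v
    rw [card_incidenceFinset_eq_degree, ← card_neighborSet_eq_degree, Set.ncard_eq_toFinset_card',
      Set.toFinset_card]
  have := hallFS (T := T) (K := Finset.univ.filter (fun v => v ∉ D)) (I := B.toFinsetᶜ) (by
    intro Z hZ
    have hZD : ∀ z ∈ Z, z ∉ D := fun z hz => (Finset.mem_filter.1 (hZ hz)).2
    rcases Z.eq_empty_or_nonempty with rfl | hne
    · simp
    have h1 := forest_card hT (Z ∪ Nb T Z Finset.univ) (hne.mono Finset.subset_union_left)
      (Z.biUnion (fun v => T.incidenceFinset v)) (by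
        intro e he
        obtain ⟨z, hz, hez⟩ := Finset.mem_biUnion.1 he
        rw [mem_incidenceFinset] at hez
        obtain ⟨he1, he2⟩ := hez
        refine ⟨he1, ?_⟩
        obtain ⟨y, rfl⟩ := he2
        intro v hv
        rcases Sym2.mem_iff.1 hv with rfl | rfl
        · exact Finset.mem_union_left _ hz
        · exact Finset.mem_union_right _ (mem_Nb.2 ⟨Finset.mem_univ _, z, hz, he1⟩))
    rw [Finset.card_biUnion (by
      intro x hx y hy hxy
      refine Finset.disjoint_left.2 ?_
      intro e he he'
      rw [mem_incidenceFinset] at he he'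
      obtain ⟨he1, he2⟩ := he
      obtain ⟨w, rfl⟩ := he2
      rcases Sym2.mem_iff.1 he'.2 with h' | h'
      · exact hxy h'.symm
      · subst h'
        exact hZD y hy ((h x (hZD x hx)).1 y he1))] at h1
    have h2 : Z.card * 3 ≤ ∑ u ∈ Z, (T.incidenceFinset u).card := by
      rw [← smul_eq_mul]
      apply Finset.card_nsmul_le_sum
      intro z hz
      rw [hinc]
      exact (h z (hZD z hz)).2
    have h3 := Finset.card_union_le Z (Nb T Z Finset.univ)
    have h4 : Nb T Z Finset.univ ⊆ Nb T Z B.toFinsetᶜ ∪ B.toFinset := by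
      intro x hx
      rw [mem_Nb] at hx
      by_cases hxB : x ∈ B
      · exact Finset.mem_union_right _ (by simpa using hxB)
      · exact Finset.mem_union_left _ (mem_Nb.2 ⟨by simpa using hxB, hx.2⟩)
    have h5 := (Finset.card_le_card h4).trans (Finset.card_union_le _ _)
    rw [Set.ncard_eq_toFinset_card'] at hB
    omega)
  obtain ⟨g, hg1, hg2⟩ := this
  refine ⟨g, fun a ha => ?_, fun a ha b hb hab => hg2 (by simpa using ha) (by simpa using hb) hab⟩
  have := hg1 a (by simpa using ha)
  exact ⟨this.2, by simpa using this.1⟩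



theorem parity_cut {W : Type*} [Fintype W] {G : SimpleGraph W} (Z : Set W) (p q : W)
    (hp : p ∈ Z) (hq : q ∉ Z)
    (hZ : ∀ x y, G.Adj x y → s(x, y) ≠ s(p, q) → (x ∈ Z ↔ y ∈ Z))
    (N N' : Finset (Sym2 W)) (hN : IsMatchingSet G N) (hN' : IsMatchingSet G N')
    (hc : covered N' = covered N) (he : s(p, q) ∈ N) : s(p, q) ∈ N' := by
  classical
  have hcard : ∀ N : Finset (Sym2 W), IsMatchingSet G N →
      (Finset.univ.filter (fun v => v ∈ covered N ∧ v ∈ Z)).card =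
        ∑ f ∈ N, (Finset.univ.filter (fun v => v ∈ f ∧ v ∈ Z)).card := by
    intro N hN
    rw [← Finset.card_biUnion]
    · congr 1
      ext v
      rw [Finset.mem_filter, Finset.mem_biUnion]
      constructor
      · rintro ⟨-, ⟨e, he, hv⟩, hz⟩
        exact ⟨e, he, Finset.mem_filter.2 ⟨Finset.mem_univ _, hv, hz⟩⟩
      · rintro ⟨e, he, hv⟩
        have hv := (Finset.mem_filter.1 hv).2
        exact ⟨Finset.mem_univ _, ⟨e, he, hv.1⟩, hv.2⟩
    · intro a ha b hb hab
      refine Finset.disjoint_left.2 ?_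
      intro v hv hv'
      simp only [Finset.mem_filter, Finset.mem_univ, true_and] at hv hv'
      exact hN.2 a ha b hb hab v hv.1 hv'.1
  have heven : ∀ f ∈ G.edgeSet, f ≠ s(p, q) →
      2 ∣ (Finset.univ.filter (fun v => v ∈ f ∧ v ∈ Z)).card := by
    intro f hf hne
    induction f with
    | _ x y =>
      have h1 := hZ x y hf hne
      have hxy : x ≠ y := G.ne_of_adj hf
      by_cases hx : x ∈ Z
      · have : Finset.univ.filter (fun v => v ∈ s(x, y) ∧ v ∈ Z) = {x, y} := by
          ext v
          simp only [Finset.mem_filter, Finset.mem_univ, true_and, Sym2.mem_iff,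
            Finset.mem_insert, Finset.mem_singleton]
          constructor
          · exact fun h => h.1
          · rintro (rfl | rfl)
            · exact ⟨Or.inl rfl, hx⟩
            · exact ⟨Or.inr rfl, h1.1 hx⟩
        rw [this, Finset.card_pair hxy]
      · have : Finset.univ.filter (fun v => v ∈ s(x, y) ∧ v ∈ Z) = ∅ := by
          ext v
          simp only [Finset.mem_filter, Finset.mem_univ, true_and, Sym2.mem_iff,
            Finset.notMem_empty, iff_false]
          rintro ⟨rfl | rfl, h⟩
          · exact hx h
          · exact hx (h1.2 h)
        rw [this]
        simp
  have hone : (Finset.univ.filter (fun v => v ∈ s(p, q) ∧ v ∈ Z)).card = 1 := by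
    have : Finset.univ.filter (fun v => v ∈ s(p, q) ∧ v ∈ Z) = {p} := by
      ext v
      simp only [Finset.mem_filter, Finset.mem_univ, true_and, Sym2.mem_iff,
        Finset.mem_singleton]
      constructor
      · rintro ⟨rfl | rfl, h⟩
        · rfl
        · exact absurd h hq
      · rintro rfl
        exact ⟨Or.inl rfl, hp⟩
    rw [this]
    simp
  by_contra hne
  have h1 := hcard N hN
  have h2 := hcard N' hN'
  rw [hc, h1, ← Finset.add_sum_erase _ _ he, hone] at h2
  have h3 : 2 ∣ ∑ f ∈ N', (Finset.univ.filter (fun v => v ∈ f ∧ v ∈ Z)).card :=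
    Finset.dvd_sum (fun f hf => heven f (hN'.1 f hf) (fun h => hne (h ▸ hf)))
  have h4 : 2 ∣ ∑ f ∈ N.erase s(p, q), (Finset.univ.filter (fun v => v ∈ f ∧ v ∈ Z)).card :=
    Finset.dvd_sum (fun f hf => heven f (hN.1 f (Finset.mem_of_mem_erase hf))
      (Finset.ne_of_mem_erase hf))
  omega

/-- edges between distinct fibers -/
theorem inter_edge {𝓑 : ∀ (X : Type), SimpleGraph X → Prop} {W V : Type} {G : SimpleGraph W}
    {T : SimpleGraph V} {S : Set V} {π : W → V} (h : ArisesFrom 𝓑 G T S π) {w w' : W}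
    (ha : G.Adj w w') (hne : π w ≠ π w') :
    T.Adj (π w) (π w') ∧ ∀ x y, G.Adj x y → π x = π w → π y = π w' → x = w ∧ y = w' := by
  obtain ⟨h1, h2, h3, h4, h5, h6, h7, h8, h9⟩ := h
  by_cases hw : π w ∈ S <;> by_cases hw' : π w' ∈ S
  · exact absurd ha (h5 _ hw _ hw' hne w w' rfl rfl)
  · have hT : T.Adj (π w) (π w') := by
      by_contra hT
      exact h7 _ hw _ hw' hT w w' rfl rfl ha
    refine ⟨hT, fun x y hxy hx hy => ?_⟩
    have := (h6 _ hw _ hw' hT).unique (y₁ := (x, y)) (y₂ := (w, w')) ⟨hx, hy, hxy⟩ ⟨rfl, rfl, ha⟩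
    simpa using this
  · have hT : T.Adj (π w') (π w) := by
      by_contra hT
      exact h7 _ hw' _ hw hT w' w rfl rfl ha.symm
    refine ⟨hT.symm, fun x y hxy hx hy => ?_⟩
    have := (h6 _ hw' _ hw hT).unique (y₁ := (y, x)) (y₂ := (w', w)) ⟨hy, hx, hxy.symm⟩
      ⟨rfl, rfl, ha.symm⟩
    simp only [Prod.mk.injEq] at this
    exact this.symm
  · exact ⟨(h3 w w' hw hw').1 ha, fun x y hxy hx hy => ⟨h2 _ hw x w hx rfl, h2 _ hw' y w' hy rfl⟩⟩

theorem inter_forced {𝓑 : ∀ (X : Type), SimpleGraph X → Prop} {W V : Type} [Fintype W]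
    {G : SimpleGraph W}
    {T : SimpleGraph V} {S : Set V} {π : W → V} (h : ArisesFrom 𝓑 G T S π) (hT : T.IsAcyclic)
    {N N' : Finset (Sym2 W)} (hN : IsMatchingSet G N) (hN' : IsMatchingSet G N')
    (hc : covered N' = covered N) {w w' : W} (he : s(w, w') ∈ N) (hne : π w ≠ π w') :
    s(w, w') ∈ N' := by
  have ha : G.Adj w w' := hN.1 _ he
  obtain ⟨hTa, hu⟩ := inter_edge h ha hne
  have hb := isAcyclic_iff_forall_adj_isBridge.1 hT hTa
  rw [isBridge_iff] at hb
  refine parity_cut {x | (T.deleteEdges {s(π w, π w')}).Reachable (π x) (π w)} w w' ?_ ?_ ?_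
    N N' hN hN' hc he
  · exact Reachable.refl _
  · intro hr
    exact hb (Reachable.symm hr)
  · intro x y hxy hne'
    by_cases hpi : π x = π y
    · simp only [Set.mem_ofPred_eq, hpi]
    · obtain ⟨hTx, -⟩ := inter_edge h hxy hpi
      have hadj : (T.deleteEdges {s(π w, π w')}).Adj (π x) (π y) := by
        rw [deleteEdges_adj]
        refine ⟨hTx, fun hmem => hne' ?_⟩
        rcases Sym2.eq_iff.1 (Set.mem_singleton_iff.1 hmem) with ⟨e1, e2⟩ | ⟨e1, e2⟩
        · obtain ⟨rfl, rfl⟩ := hu x y hxy e1 e2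
          rfl
        · obtain ⟨rfl, rfl⟩ := hu y x hxy.symm e2 e1
          exact Sym2.eq_swap
      exact ⟨fun hr => hadj.symm.reachable.trans hr, fun hr => hadj.reachable.trans hr⟩

theorem ur_assemble {𝓑 : ∀ (X : Type), SimpleGraph X → Prop} {W V : Type} [Fintype W]
    {G : SimpleGraph W}
    {T : SimpleGraph V} {S : Set V} {π : W → V} (h : ArisesFrom 𝓑 G T S π) (hT : T.IsAcyclic)
    {M : Finset (Sym2 W)} (hM : IsMatchingSet G M)
    (hS : ∀ s ∈ S, ∃ N ⊆ M, (∀ e ∈ M, (∀ v ∈ e, π v = s) → e ∈ N) ∧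
      (∀ v ∈ covered N, π v = s) ∧ IsURMatching G N) : IsURMatching G M := by
  classical
  refine ⟨hM, fun M' hM' hc => ?_⟩
  have hsub : ∀ N N' : Finset (Sym2 W), IsMatchingSet G N → IsMatchingSet G N' →
      covered N' = covered N → ∀ s, 
      covered (N.filter (fun e => ∀ v ∈ e, π v = s)) ⊆
        covered (N'.filter (fun e => ∀ v ∈ e, π v = s)) := by
    rintro N N' hN hN' hc s v ⟨e, he, hv⟩
    rw [Finset.mem_filter] at he
    have hvs := he.2 v hv
    have : v ∈ covered N' := by
      rw [hc]; exact ⟨e, he.1, hv⟩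
    obtain ⟨f, hf, hvf⟩ := this
    refine ⟨f, Finset.mem_filter.2 ⟨hf, ?_⟩, hvf⟩
    obtain ⟨y, rfl⟩ := hvf
    by_contra hns
    have hy : π v ≠ π y := by
      intro hh
      apply hns
      intro x hx
      rcases Sym2.mem_iff.1 hx with rfl | rfl
      · exact hvs
      · rw [← hh]; exact hvs
    have hfN := inter_forced h hT hN' hN hc.symm hf hy
    by_cases hef : e = s(v, y)
    · exact hns (hef ▸ he.2)
    · exact hN.2 e he.1 _ hfN hef v hv (by simp)
  have hfib : ∀ s ∈ S, M'.filter (fun e => ∀ v ∈ e, π v = s) = M.filter (fun e => ∀ v ∈ e, π v = s) := by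
    intro s hs
    obtain ⟨N, hNM, hN1, hN2, hN3⟩ := hS s hs
    have hNeq : M.filter (fun e => ∀ v ∈ e, π v = s) = N := by
      ext e
      rw [Finset.mem_filter]
      exact ⟨fun he => hN1 e he.1 he.2, fun he => ⟨hNM he, fun v hv => hN2 v ⟨e, he, hv⟩⟩⟩
    have hcc := Set.Subset.antisymm (hsub M' M hM' hM hc.symm s) (hsub M M' hM hM' hc s)
    rw [hNeq] at hcc ⊢
    refine hN3.2 _ ⟨fun e he => hM'.1 e (Finset.filter_subset _ _ he), fun e he f hf =>
      hM'.2 e (Finset.filter_subset _ _ he) f (Finset.filter_subset _ _ hf)⟩ hcc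
  have key : ∀ N N' : Finset (Sym2 W), IsMatchingSet G N → IsMatchingSet G N' →
      covered N' = covered N → (∀ s ∈ S, N'.filter (fun e => ∀ v ∈ e, π v = s) =
        N.filter (fun e => ∀ v ∈ e, π v = s)) → N ⊆ N' := by
    intro N N' hN hN' hc hf e he
    induction e with
    | _ x y =>
      by_cases hxy : π x = π y
      · by_cases hs : π x ∈ S
        · have : s(x, y) ∈ N.filter (fun e => ∀ v ∈ e, π v = π x) := by
            refine Finset.mem_filter.2 ⟨he, fun v hv => ?_⟩
            rcases Sym2.mem_iff.1 hv with rfl | rfl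
            · rfl
            · exact hxy.symm
          rw [← hf _ hs] at this
          exact (Finset.mem_filter.1 this).1
        · have hadj : G.Adj x y := hN.1 _ he
          exact absurd (h.2.1 _ hs x y rfl hxy.symm) hadj.ne
      · exact inter_forced h hT hN hN' hc he hxy
  exact Finset.Subset.antisymm (key M' M hM' hM hc.symm (fun s hs => (hfib s hs).symm))
    (key M M' hM hM' hc hfib)

theorem block_fiber {X : Type} {H : SimpleGraph X} (h : IsBlockB X H) : ∃ k, BlockFact H k := by
  rcases h with ⟨⟨f⟩⟩ | ⟨⟨f⟩⟩ | ⟨⟨f⟩⟩ | ⟨⟨f⟩⟩ | ⟨⟨f⟩⟩ | ⟨⟨f⟩⟩ | ⟨⟨f⟩⟩ | ⟨⟨f⟩⟩ | ⟨⟨f⟩⟩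
  · exact ⟨_, bf1.iso f⟩
  · exact ⟨_, bf2.iso f⟩
  · exact ⟨_, bf3.iso f⟩
  · exact ⟨_, bf4.iso f⟩
  · exact ⟨_, bf5.iso f⟩
  · exact ⟨_, bf6.iso f⟩
  · exact ⟨_, bf7.iso f⟩
  · exact ⟨_, bf8.iso f⟩
  · exact ⟨_, bf9.iso f⟩

theorem nuUR_eq {V : Type*} {G : SimpleGraph V} {t : ℕ}
    (h1 : ∀ M, IsURMatching G M → M.card ≤ t) (h2 : ∃ M, IsURMatching G M ∧ M.card = t) :
    nuUR G = t := by
  unfold nuUR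
  refine le_antisymm (csSup_le ?_ ?_) (le_csSup ⟨t, ?_⟩ h2)
  · exact ⟨t, h2⟩
  · rintro k ⟨M, hM, rfl⟩
    exact h1 M hM
  · rintro k ⟨M, hM, rfl⟩
    exact h1 M hM



theorem lift_edge {𝓑 : ∀ (X : Type), SimpleGraph X → Prop} {W V : Type} {G : SimpleGraph W}
    {T : SimpleGraph V} {S : Set V} {π : W → V} (h : ArisesFrom 𝓑 G T S π) {a b : V}
    (ha : a ∉ S) (hab : T.Adj a b) : ∃ p : W × W, π p.1 = a ∧ π p.2 = b ∧ G.Adj p.1 p.2 := by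
  obtain ⟨h1, h2, h3, h4, h5, h6, h7, h8, h9⟩ := h
  by_cases hb : b ∈ S
  · obtain ⟨p, ⟨hp1, hp2, hp3⟩, -⟩ := h6 b hb a ha hab.symm
    exact ⟨(p.2, p.1), hp2, hp1, hp3.symm⟩
  · obtain ⟨w, rfl⟩ := h1 a
    obtain ⟨u, rfl⟩ := h1 b
    exact ⟨(w, u), rfl, rfl, (h3 w u ha hb).2 hab⟩

theorem upper_bd {W V : Type} [Fintype W] [Fintype V] [DecidableEq V] {G : SimpleGraph W}
    {T : SimpleGraph V} {S D : Set V} {π : W → V} (h : ArisesFrom IsBlockB G T S π)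
    (hS : S ⊆ D) (hD : ∀ u ∈ D, ∀ v ∈ D, ¬ T.Adj u v) (k : V → ℕ)
    (hk : ∀ s ∈ S, BlockFact (G.induce (π ⁻¹' {s})) (k s))
    (Af Sf : Finset V) (hAf : ∀ v, v ∈ Af ↔ v ∉ D) (hSf : ∀ v, v ∈ Sf ↔ v ∈ S)
    (M : Finset (Sym2 W)) (hM : IsURMatching G M) : M.card ≤ Af.card + ∑ s ∈ Sf, k s := by
  classical
  have hsub : M ⊆ M.filter (fun e => ∃ v, v ∈ e ∧ π v ∉ D) ∪
      Sf.biUnion (fun s => M.filter (fun e => ∀ v ∈ e, π v = s)) := by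
    intro e he
    by_cases hA : ∃ v, v ∈ e ∧ π v ∉ D
    · exact Finset.mem_union_left _ (Finset.mem_filter.2 ⟨he, hA⟩)
    · push Not at hA
      have hadj := hM.1.1 e he
      induction e with
      | _ x y =>
        have hxy : G.Adj x y := hadj
        have hx := hA x (by simp)
        have hy := hA y (by simp)
        have hpi : π x = π y := by
          by_contra hne
          exact hD _ hx _ hy (inter_edge h hxy hne).1
        have hxS : π x ∈ S := by
          by_contra hns
          exact hxy.ne (h.2.1 _ hns x y rfl hpi.symm)
        refine Finset.mem_union_right _ (Finset.mem_biUnion.2 ⟨π x, (hSf _).2 hxS,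
          Finset.mem_filter.2 ⟨he, fun v hv => ?_⟩⟩)
        rcases Sym2.mem_iff.1 hv with rfl | rfl
        · rfl
        · exact hpi.symm
  have h1 : (M.filter (fun e => ∃ v, v ∈ e ∧ π v ∉ D)).card ≤ Af.card := by
    have hch : ∀ e : Sym2 W, ∃ v : W, (e ∈ M.filter (fun e => ∃ v, v ∈ e ∧ π v ∉ D)) →
        v ∈ e ∧ π v ∉ D := by
      intro e
      by_cases he : ∃ v, v ∈ e ∧ π v ∉ D
      · obtain ⟨v, hv⟩ := he
        exact ⟨v, fun _ => hv⟩
      · induction e with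
        | _ x y => exact ⟨x, fun hh => absurd (Finset.mem_filter.1 hh).2 he⟩
    choose c hc using hch
    refine Finset.card_le_card_of_injOn (fun e => π (c e)) (fun e he => (hAf _).2 (hc e he).2) ?_
    intro e he f hf hef
    have hce := hc e he
    have hcf := hc f hf
    have heq : c e = c f := h.2.1 (π (c f)) (fun hs => hcf.2 (hS hs)) _ _ hef rfl
    by_contra hne
    exact hM.1.2 e (Finset.filter_subset _ _ he) f (Finset.filter_subset _ _ hf) hne _ hce.1
      (heq ▸ hcf.1)
  have h2 : ∀ s ∈ Sf, (M.filter (fun e => ∀ v ∈ e, π v = s)).card ≤ k s := by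
    intro s hs
    have hur := ur_subset hM (Finset.filter_subset (fun e => ∀ v ∈ e, π v = s) M)
    obtain ⟨N, hN⟩ := pull_set (Embedding.induce (π ⁻¹' {s}) : G.induce (π ⁻¹' {s}) ↪g G).toEmbedding
      (M.filter (fun e => ∀ v ∈ e, π v = s)) (by
        rintro v ⟨e, he, hv⟩
        exact ⟨⟨v, (Finset.mem_filter.1 he).2 v hv⟩, rfl⟩)
    rw [← hN] at hur ⊢
    rw [Finset.card_map]
    exact (hk s ((hSf s).1 hs)).1 N ((ur_map_iff _ N).1 hur)
  have h3 := (Finset.card_le_card hsub).trans (Finset.card_union_le _ _)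
  have h4 := (Finset.card_biUnion_le (s := Sf)
    (t := fun s => M.filter (fun e => ∀ v ∈ e, π v = s))).trans (Finset.sum_le_sum h2)
  omega

theorem fiber_match {W V : Type} [Fintype W] {G : SimpleGraph W} {π : W → V} {s : V} {k : ℕ}
    (hk : BlockFact (G.induce (π ⁻¹' {s})) k) (Y : Set W) (hY : Y.ncard ≤ 2)
    (hYs : ∀ y ∈ Y, π y = s)
    (hY2 : ∀ y ∈ Y, (G.neighborSet y ∩ π ⁻¹' {s}).ncard = 2) :
    ∃ N : Finset (Sym2 W), IsURMatching G N ∧ N.card = k ∧ (∀ v ∈ covered N, π v = s) ∧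
      ∀ v ∈ covered N, v ∉ Y := by
  obtain ⟨N, hN1, hN2, hN3⟩ := hk.2 (Subtype.val ⁻¹' Y) (by
    rw [← Set.ncard_image_of_injective _ Subtype.val_injective]
    exact (Set.ncard_le_ncard (Set.image_preimage_subset _ _) (Set.toFinite _)).trans hY)
    (Set.toFinite _) (by
    intro y hy
    rw [← hY2 y hy, ← Set.ncard_image_of_injective _ Subtype.val_injective]
    congr 1
    ext x
    constructor
    · rintro ⟨z, hz, rfl⟩
      exact ⟨hz, z.2⟩
    · rintro ⟨hx, hxs⟩
      exact ⟨⟨x, hxs⟩, hx, rfl⟩)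
  refine ⟨N.map (Embedding.induce (π ⁻¹' {s}) : G.induce (π ⁻¹' {s}) ↪g G).toEmbedding.sym2Map,
    (ur_map_iff _ N).2 hN1, by rw [Finset.card_map, hN2], ?_, ?_⟩
  · rw [covered_map]
    rintro v ⟨x, hx, rfl⟩
    exact x.2
  · rw [covered_map]
    rintro v ⟨x, hx, rfl⟩ hv
    exact hN3 x hv hx

theorem main_thm {W V : Type} [Fintype W] [Finite V] (G : SimpleGraph W)
    (T : SimpleGraph V) (S : Set V) (π : W → V)
    (hT : MemT T) (hS : S ⊆ gallaiD T)
    (hAr : ArisesFrom IsBlockB G T S π)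
    (X : Set W)
    (hX : X ⊆ {w : W | π w ∈ gallaiD T ∧ π w ∉ S} ∪
      {w : W | (G.neighborSet w).ncard = 2})
    (hcard : X.ncard ≤ 2) :
    nuUR (G.induce Xᶜ) = nuUR G := by
  classical
  have : Fintype V := Fintype.ofFinite V
  obtain ⟨hind, hst⟩ := tree_struct hT
  have hac := hT.1.isAcyclic
  have : Nonempty V := hT.1.connected.nonempty
  have : Nonempty W := ⟨(hAr.1 (Classical.arbitrary V)).choose⟩
  generalize gallaiD T = D at *
  have hAS : ∀ {a}, a ∉ D → a ∉ S := fun ha h => ha (hS h)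
  have hk0 : ∀ s, ∃ k, s ∈ S → BlockFact (G.induce (π ⁻¹' {s})) k := by
    intro s
    by_cases hs : s ∈ S
    · obtain ⟨k, hk⟩ := block_fiber (hAr.2.2.2.1 s hs)
      exact ⟨k, fun _ => hk⟩
    · exact ⟨0, fun h => absurd h hs⟩
  choose k hk using hk0
  have hX' : ∀ x ∈ X, (π x ∈ D ∧ π x ∉ S) ∨ (G.neighborSet x).ncard = 2 := fun x hx => hX hx
  obtain ⟨g, hg1, hg2⟩ := select hac D hst (π '' X)
    ((Set.ncard_image_le (Set.toFinite _)).trans hcard)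
  have hp : ∀ a, ∃ p : W × W, a ∉ D → π p.1 = a ∧ π p.2 = g a ∧ G.Adj p.1 p.2 := by
    intro a
    by_cases ha : a ∈ D
    · exact ⟨Classical.arbitrary _, fun h => absurd ha h⟩
    · obtain ⟨p, hp⟩ := lift_edge hAr (hAS ha) (hg1 a ha).1
      exact ⟨p, fun _ => hp⟩
  choose p hp using hp
  set U : Set W := {y | ∃ a ∉ D, y = (p a).2} with hU
  have hgD : ∀ a ∉ D, g a ∈ D := fun a ha => (hst a ha).1 _ (hg1 a ha).1
  have hN0 : ∀ s, ∃ N : Finset (Sym2 W), s ∈ S → IsURMatching G N ∧ N.card = k s ∧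
      (∀ v ∈ covered N, π v = s) ∧ ∀ v ∈ covered N, v ∉ U ∪ X := by
    intro s
    by_cases hs : s ∈ S
    swap
    · exact ⟨∅, fun h => absurd h hs⟩
    obtain ⟨N, hN1, hN2, hN3, hN4⟩ := fiber_match (hk s hs) ((U ∪ X) ∩ π ⁻¹' {s}) (by
      by_cases hex : ∃ a ∉ D, g a = s
      · obtain ⟨a, ha, has⟩ := hex
        have : (U ∪ X) ∩ π ⁻¹' {s} ⊆ {(p a).2} := by
          rintro y ⟨⟨b, hb, rfl⟩ | hy, hys⟩
          · have e1 : π (p b).2 = s := hys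
            rw [(hp b hb).2.1, ← has] at e1
            rw [hg2 b hb a ha e1]
            rfl
          · exact absurd ⟨y, hy, hys.trans has.symm⟩ (hg1 a ha).2
        have h2 := Set.ncard_le_ncard this (Set.toFinite _)
        rw [Set.ncard_singleton] at h2
        omega
      · refine (Set.ncard_le_ncard ?_ (Set.toFinite _)).trans hcard
        rintro y ⟨⟨b, hb, rfl⟩ | hy, hys⟩
        · exact absurd ⟨b, hb, (hp b hb).2.1.symm.trans hys⟩ hex
        · exact hy) (fun y hy => hy.2) (by
      rintro y ⟨hy, hys⟩
      have hys' : π y = s := hys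
      by_cases hout : ∃ w', π w' ≠ s ∧ G.Adj y w'
      · obtain ⟨w', hw1, hw2⟩ := hout
        exact hAr.2.2.2.2.2.2.2.2 s hs y hys w' hw1 hw2
      · push Not at hout
        rcases hy with ⟨b, hb, rfl⟩ | hy
        · exfalso
          refine hout (p b).1 ?_ (hp b hb).2.2.symm
          rw [(hp b hb).1]
          rintro rfl
          exact hb (hS hs)
        · rcases hX' y hy with h | h
          · exact absurd (hys'.symm ▸ hs) h.2
          · rw [← h]
            congr 1
            ext z
            refine ⟨fun hz => hz.1, fun hz => ⟨hz, ?_⟩⟩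
            by_contra hzs
            exact hout z hzs hz)
    exact ⟨N, fun _ => ⟨hN1, hN2, hN3, fun v hv hvU => hN4 v hv ⟨hvU, hN3 v hv⟩⟩⟩
  choose N hN using hN0
  set Af : Finset V := Finset.univ.filter (fun v => v ∉ D) with hAf0
  set Sf : Finset V := Finset.univ.filter (fun v => v ∈ S) with hSf0
  have hAf : ∀ v, v ∈ Af ↔ v ∉ D := by simp [hAf0]
  have hSf : ∀ v, v ∈ Sf ↔ v ∈ S := by simp [hSf0]
  have hup := upper_bd hAr hS hind k hk Af Sf hAf hSf
  set E : Finset (Sym2 W) := Af.image (fun a => s((p a).1, (p a).2)) with hE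
  have hEmem : ∀ e ∈ E, ∃ a ∉ D, e = s((p a).1, (p a).2) := by
    intro e he
    obtain ⟨a, ha, rfl⟩ := Finset.mem_image.1 he
    exact ⟨a, (hAf a).1 ha, rfl⟩
  have hEE : ∀ a ∉ D, ∀ b ∉ D, ∀ v, v ∈ s((p a).1, (p a).2) → v ∈ s((p b).1, (p b).2) → a = b := by
    intro a ha b hb v hv hv'
    obtain ⟨a1, a2, -⟩ := hp a ha
    obtain ⟨b1, b2, -⟩ := hp b hb
    rcases Sym2.mem_iff.1 hv with rfl | rfl <;> rcases Sym2.mem_iff.1 hv' with h | h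
    · rw [← a1, ← b1, h]
    · exfalso
      apply ha
      rw [← a1, h, b2]
      exact hgD b hb
    · exfalso
      apply hb
      rw [← b1, ← h, a2]
      exact hgD a ha
    · apply hg2 a ha b hb
      rw [← a2, ← b2, h]
  have hEN : ∀ a ∉ D, ∀ s ∈ S, ∀ v, v ∈ s((p a).1, (p a).2) → v ∈ covered (N s) → False := by
    intro a ha s hs v hv hv'
    obtain ⟨a1, a2, -⟩ := hp a ha
    obtain ⟨n1, n2, n3, n4⟩ := hN s hs
    rcases Sym2.mem_iff.1 hv with rfl | rfl
    · apply ha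
      rw [← a1, n3 _ hv']
      exact hS hs
    · exact n4 _ hv' (Or.inl ⟨a, ha, rfl⟩)
  have hNN : ∀ s ∈ S, ∀ s' ∈ S, ∀ v, v ∈ covered (N s) → v ∈ covered (N s') → s = s' := by
    intro s hs s' hs' v hv hv'
    rw [← (hN s hs).2.2.1 v hv, ← (hN s' hs').2.2.1 v hv']
  set M : Finset (Sym2 W) := E ∪ Sf.biUnion N with hMdef
  have hMmem : ∀ e ∈ M, (∃ a ∉ D, e = s((p a).1, (p a).2)) ∨ ∃ s ∈ S, e ∈ N s := by
    intro e he
    rcases Finset.mem_union.1 he with he | he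
    · exact Or.inl (hEmem e he)
    · obtain ⟨s, hs, he⟩ := Finset.mem_biUnion.1 he
      exact Or.inr ⟨s, (hSf s).1 hs, he⟩
  have hex : ∀ e : Sym2 W, ∃ v, v ∈ e := by
    intro e
    induction e with
    | _ x y => exact ⟨x, by simp⟩
  have hMm : IsMatchingSet G M := by
    refine ⟨fun e he => ?_, fun e he f hf hne v hv hv' => ?_⟩
    · rcases hMmem e he with ⟨a, ha, rfl⟩ | ⟨s, hs, he⟩
      · exact (hp a ha).2.2
      · exact (hN s hs).1.1.1 e he
    · rcases hMmem e he with ⟨a, ha, rfl⟩ | ⟨s, hs, he⟩ <;>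
        rcases hMmem f hf with ⟨b, hb, rfl⟩ | ⟨s', hs', hf⟩
      · exact hne (by rw [hEE a ha b hb v hv hv'])
      · exact hEN a ha s' hs' v hv ⟨f, hf, hv'⟩
      · exact hEN b hb s hs v hv' ⟨e, he, hv⟩
      · obtain rfl := hNN s hs s' hs' v ⟨e, he, hv⟩ ⟨f, hf, hv'⟩
        exact (hN s hs).1.1.2 e he f hf hne v hv hv'
  have hMc : M.card = Af.card + ∑ s ∈ Sf, k s := by
    rw [hMdef, Finset.card_union_of_disjoint, hE, Finset.card_image_of_injOn, Finset.card_biUnion]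
    · congr 1
      exact Finset.sum_congr rfl (fun s hs => (hN s ((hSf s).1 hs)).2.1)
    · intro s hs s' hs' hne
      refine Finset.disjoint_left.2 fun e he he' => ?_
      obtain ⟨v, hv⟩ := hex e
      exact hne (hNN s ((hSf s).1 hs) s' ((hSf s').1 hs') v ⟨e, he, hv⟩ ⟨e, he', hv⟩)
    · intro a ha b hb hab
      have hab' : s((p a).1, (p a).2) = s((p b).1, (p b).2) := hab
      refine hEE a ((hAf a).1 ha) b ((hAf b).1 hb) (p a).1 (by simp) ?_
      rw [← hab']
      simp
    · refine Finset.disjoint_left.2 fun e he he' => ?_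
      obtain ⟨a, ha, rfl⟩ := hEmem e he
      obtain ⟨s, hs, he'⟩ := Finset.mem_biUnion.1 he'
      exact hEN a ha s ((hSf s).1 hs) (p a).1 (by simp) ⟨_, he', by simp⟩
  have hMur : IsURMatching G M := by
    refine ur_assemble hAr hac hMm fun s hs => ⟨N s, ?_, ?_, (hN s hs).2.2.1, (hN s hs).1⟩
    · intro e he
      exact Finset.mem_union_right _ (Finset.mem_biUnion.2 ⟨s, (hSf s).2 hs, he⟩)
    · intro e he hes
      rcases hMmem e he with ⟨a, ha, rfl⟩ | ⟨s', hs', he⟩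
      · exfalso
        apply ha
        rw [← (hp a ha).1, hes (p a).1 (by simp)]
        exact hS hs
      · obtain ⟨v, hv⟩ := hex e
        have e1 := hes v hv
        rw [(hN s' hs').2.2.1 v ⟨e, he, hv⟩] at e1
        rwa [← e1]
  have hMX : covered M ⊆ Xᶜ := by
    rintro v ⟨e, he, hv⟩ hvX
    rcases hMmem e he with ⟨a, ha, rfl⟩ | ⟨s, hs, he⟩
    · rcases Sym2.mem_iff.1 hv with rfl | rfl
      · rcases hX' _ hvX with h | h
        · exact ha ((hp a ha).1 ▸ h.1)
        · have h3 := (hst a ha).2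
          have hsub : T.neighborSet a ⊆ π '' G.neighborSet (p a).1 := by
            intro d hd
            obtain ⟨q, hq1, hq2, hq3⟩ := lift_edge hAr (hAS ha) hd
            have : q.1 = (p a).1 := hAr.2.1 a (hAS ha) _ _ hq1 (hp a ha).1
            exact ⟨q.2, this ▸ hq3, hq2⟩
          have h4 := (Set.ncard_le_ncard hsub (Set.toFinite _)).trans
            (Set.ncard_image_le (Set.toFinite _))
          omega
      · exact (hg1 a ha).2 ⟨_, hvX, (hp a ha).2.1⟩
    · exact (hN s hs).2.2.2 v ⟨e, he, hv⟩ (Or.inr hvX)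
  rw [nuUR_eq hup ⟨M, hMur, hMc⟩]
  obtain ⟨M1, hM1⟩ := pull_set (Embedding.induce Xᶜ : G.induce Xᶜ ↪g G).toEmbedding M (by
    intro v hv
    exact ⟨⟨v, hMX hv⟩, rfl⟩)
  apply nuUR_eq
  · intro M' hM'
    have := hup _ ((ur_map_iff (Embedding.induce Xᶜ : G.induce Xᶜ ↪g G) M').2 hM')
    rwa [Finset.card_map] at this
  · refine ⟨M1, ?_, ?_⟩
    · rw [← ur_map_iff (Embedding.induce Xᶜ : G.induce Xᶜ ↪g G), hM1]
      exact hMur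
    · rw [← hMc, ← hM1, Finset.card_map]


/-- Lemma 8 of the paper. Let `G ∈ 𝒢` with host tree `T`
(replaced set `S ⊆ D_T`, projection `π`), and let
`X ⊆ D_T' ∪ {u ∈ V(G) : deg_G(u) = 2}`, where `D_T'` is the set of
non-replaced vertices of `D_T`, viewed inside `G`. If `|X| ≤ 2`, then
`ν_ur(G - X) = ν_ur(G)`. -/
theorem statement15 {W V : Type} [Fintype W] [Finite V] (G : SimpleGraph W)
    (T : SimpleGraph V) (S : Set V) (π : W → V)
    (hT : MemT T) (hS : S ⊆ gallaiD T)
    (hAr : ArisesFrom IsBlockB G T S π)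
    (X : Set W)
    (hX : X ⊆ {w : W | π w ∈ gallaiD T ∧ π w ∉ S} ∪
      {w : W | (G.neighborSet w).ncard = 2})
    (hcard : X.ncard ≤ 2) :
    nuUR (G.induce Xᶜ) = nuUR G := by
  exact main_thm G T S π hT hS hAr X hX hcard

end URPaper
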